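/- arXiv:2202.05471 — 2 statements merged into one kernel-verified Lean document; each statement's English description precedes it below -/
import Mathlib

section
/- Let p be a positive integer, λ > 0 a real number, and let f = (f₁, …, f_p) : D → D^p be a map that extends C¹-smoothly to the closed unit disc and satisfies d_p(f(z), f(w)) = √λ · ρ(z, w) for all z, w ∈ D (the metric formulation of a totally geodesic isometric embedding of (D, λ g_D) into (D^p, g_{D^p})). Then λ is a positive integer with λ ≤ p, and there exists a subset S ⊆ {1, …, p} with exactly λ elements such that for each j ∈ S the component f_j is either a Möbius automorphism of D or the complex conjugate of a Möbius automorphism of D, and for each j ∉ S the component f_j is constant. -/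
open Complex Metric Set Filter

noncomputable section

/-- The open unit disc in `ℂ`. -/
def unitDisc : Set ℂ := {z : ℂ | ‖z‖ < 1}

/-- The closed unit disc in `ℂ`. -/
def closedUnitDisc : Set ℂ := {z : ℂ | ‖z‖ ≤ 1}

/-- Inverse hyperbolic tangent. -/
def artanh (x : ℝ) : ℝ := Real.log ((1 + x) / (1 - x)) / 2

/-- The Poincaré distance on the unit disc. -/
def pdist (z w : ℂ) : ℝ := artanh (‖(z - w) / (1 - (starRingEnd ℂ) w * z)‖)

/-- The distance of the product Poincaré metric on the polydisc `D^p`,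
for maps given by their `p` components. -/
def polyDist (p : ℕ) (z w : Fin p → ℂ) : ℝ :=
  Real.sqrt (∑ j, (pdist (z j) (w j)) ^ 2)

/-- `f` agrees on the unit disc with a Möbius automorphism
`z ↦ e^{iθ}(z - a)/(1 - conj(a) z)` of the disc. -/
def IsMobiusOn (f : ℂ → ℂ) : Prop :=
  ∃ (θ : ℝ) (a : ℂ), ‖a‖ < 1 ∧
    ∀ z ∈ unitDisc, f z = Complex.exp (θ * Complex.I) * ((z - a) / (1 - (starRingEnd ℂ) a * z))


lemma pd_exp {x : ℝ} (h0 : 0 ≤ x) (h1 : x < 1) :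
    Real.exp (2 * artanh x) = (1 + x) / (1 - x) := by
  unfold artanh
  rw [mul_div_cancel₀ _ (two_ne_zero), Real.exp_log]
  apply div_pos <;> linarith

lemma pd_cosh_artanh {x : ℝ} (h0 : 0 ≤ x) (h1 : x < 1) :
    Real.cosh (2 * artanh x) = (1 + x ^ 2) / (1 - x ^ 2) := by
  rw [Real.cosh_eq, Real.exp_neg, pd_exp h0 h1]
  have a : (1 - x) ≠ 0 := by linarith
  have b : (1 + x) ≠ 0 := by linarith
  have c : 1 - x ^ 2 ≠ 0 := by
    have : 1 - x ^ 2 = (1 - x) * (1 + x) := by ring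
    rw [this]; exact mul_ne_zero a b
  field_simp
  ring

lemma pd_artanh_nonneg {x : ℝ} (h0 : 0 ≤ x) (h1 : x < 1) : 0 ≤ artanh x := by
  unfold artanh
  apply div_nonneg _ zero_le_two
  apply Real.log_nonneg
  rw [le_div_iff₀ (by linarith)]
  linarith

/-- `sinh² ρ`. -/
def dl (z w : ℂ) : ℝ := normSq (z - w) / ((1 - normSq z) * (1 - normSq w))

lemma mem_iff (z : ℂ) : z ∈ unitDisc ↔ normSq z < 1 := by
  unfold unitDisc
  rw [normSq_eq_norm_sq]
  simp [sq_lt_one_iff₀ (norm_nonneg z)]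

lemma key_id (z w : ℂ) : normSq (1 - (starRingEnd ℂ) w * z) =
    normSq (z - w) + (1 - normSq z) * (1 - normSq w) := by
  simp [normSq_apply]; ring

lemma dl_nonneg {z w : ℂ} (hz : z ∈ unitDisc) (hw : w ∈ unitDisc) : 0 ≤ dl z w := by
  rw [mem_iff] at hz hw
  apply div_nonneg (normSq_nonneg _)
  apply mul_nonneg <;> linarith

lemma pd_arg_sq (z w : ℂ) (hz : z ∈ unitDisc) (hw : w ∈ unitDisc) :
    ‖(z - w) / (1 - (starRingEnd ℂ) w * z)‖ ^ 2 = dl z w / (1 + dl z w) := by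
  rw [← normSq_eq_norm_sq, normSq_div, key_id]
  rw [mem_iff] at hz hw
  have h1 : 0 < (1 - normSq z) := by linarith
  have h2 : 0 < (1 - normSq w) := by linarith
  unfold dl
  have := normSq_nonneg (z - w)
  have h3 : 0 < normSq (z - w) + (1 - normSq z) * (1 - normSq w) := by positivity
  have h4 : 0 < 1 + normSq (z - w) / ((1 - normSq z) * (1 - normSq w)) := by positivity
  field_simp
  ring

lemma pd_arg_lt (z w : ℂ) (hz : z ∈ unitDisc) (hw : w ∈ unitDisc) :
    ‖(z - w) / (1 - (starRingEnd ℂ) w * z)‖ < 1 := by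
  have h := pd_arg_sq z w hz hw
  have := dl_nonneg hz hw
  rw [← sq_lt_one_iff₀ (norm_nonneg _), h, div_lt_one (by linarith)]
  linarith

lemma pd_nonneg {z w : ℂ} (hz : z ∈ unitDisc) (hw : w ∈ unitDisc) : 0 ≤ pdist z w :=
  pd_artanh_nonneg (norm_nonneg _) (pd_arg_lt z w hz hw)

lemma pd_cosh {z w : ℂ} (hz : z ∈ unitDisc) (hw : w ∈ unitDisc) :
    Real.cosh (2 * pdist z w) = 1 + 2 * dl z w := by
  unfold pdist
  rw [pd_cosh_artanh (norm_nonneg _) (pd_arg_lt z w hz hw), pd_arg_sq z w hz hw]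
  have := dl_nonneg hz hw
  have : 1 + dl z w ≠ 0 := by linarith
  have e : 1 - dl z w / (1 + dl z w) = 1 / (1 + dl z w) := by field_simp; ring
  rw [e]
  field_simp
  ring

lemma pd_le {z w z' w' : ℂ} (hz : z ∈ unitDisc) (hw : w ∈ unitDisc) (hz' : z' ∈ unitDisc)
    (hw' : w' ∈ unitDisc) : pdist z w ≤ pdist z' w' ↔ dl z w ≤ dl z' w' := by
  have h1 := pd_nonneg hz hw
  have h2 := pd_nonneg hz' hw'
  have : Real.cosh (2 * pdist z w) ≤ Real.cosh (2 * pdist z' w') ↔ _ := Real.cosh_le_cosh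
  rw [pd_cosh hz hw, pd_cosh hz' hw', abs_of_nonneg (by linarith), abs_of_nonneg (by linarith)] at this
  constructor
  · intro h; have := this.2 (by linarith); linarith
  · intro h; have := this.1 (by linarith); linarith

lemma pd_eq {z w z' w' : ℂ} (hz : z ∈ unitDisc) (hw : w ∈ unitDisc) (hz' : z' ∈ unitDisc)
    (hw' : w' ∈ unitDisc) : pdist z w = pdist z' w' ↔ dl z w = dl z' w' := by
  rw [le_antisymm_iff, le_antisymm_iff, pd_le hz hw hz' hw', pd_le hz' hw' hz hw]

lemma dl_comm (z w : ℂ) : dl z w = dl w z := by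
  unfold dl
  rw [← neg_sub z w, normSq_neg, mul_comm]

lemma pd_comm {z w : ℂ} (hz : z ∈ unitDisc) (hw : w ∈ unitDisc) : pdist z w = pdist w z := by
  rw [pd_eq hz hw hw hz, dl_comm]

lemma zero_mem_disc : (0 : ℂ) ∈ unitDisc := by simp [mem_iff]

lemma ofReal_mem {u : ℝ} (h : |u| < 1) : (u : ℂ) ∈ unitDisc := by
  unfold unitDisc; simpa using h

lemma pd_real {u v : ℝ} (hu : -1 < u) (huv : u ≤ v) (hv : v < 1) :
    pdist u v = artanh v - artanh u := by
  have h1 : 0 < 1 - u * v := by nlinarith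
  have : ‖((u : ℂ) - v) / (1 - (starRingEnd ℂ) (v : ℂ) * u)‖ = (v - u) / (1 - u * v) := by
    have : ((u : ℂ) - v) / (1 - (starRingEnd ℂ) (v : ℂ) * u) = ((-((v - u) / (1 - u * v)) : ℝ) : ℂ) := by
      rw [conj_ofReal]; push_cast; rw [← neg_div]; congr 1 <;> ring
    rw [this, norm_real, norm_neg, Real.norm_eq_abs, abs_of_nonneg]
    apply div_nonneg <;> linarith
  unfold pdist artanh
  rw [this, ← sub_div, ← Real.log_div]
  · congr 2
    generalize hq : 1 - u * v = q at h1
    have : (1 - v) ≠ 0 := by linarith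
    have : (1 - u) ≠ 0 := by linarith
    have : (1 + u) ≠ 0 := by linarith
    have h2 : 1 - (v - u) / q = (1 - v) * (1 + u) / q := by
      field_simp; rw [← hq]; ring
    have h3 : 1 + (v - u) / q = (1 + v) * (1 - u) / q := by
      field_simp; rw [← hq]; ring
    rw [h2, h3]
    field_simp
  · exact (div_pos (by linarith) (by linarith)).ne'
  · exact (div_pos (by linarith) (by linarith)).ne'

lemma artanh_zero : artanh 0 = 0 := by simp [artanh]

lemma artanh_neg (u : ℝ) : artanh (-u) = - artanh u := by
  unfold artanh
  rw [← neg_div, ← Real.log_inv, inv_div]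
  congr 2; ring

/-- The disc automorphism taking `0` to `a`. -/
def mb (a z : ℂ) : ℂ := (z + a) / (1 + (starRingEnd ℂ) a * z)

lemma mb_den {a z : ℂ} (ha : a ∈ unitDisc) (hz : ‖z‖ ≤ 1) : 1 + (starRingEnd ℂ) a * z ≠ 0 := by
  intro h
  have h2 : (starRingEnd ℂ) a * z = -1 := by linear_combination h
  have h3 : ‖a‖ * ‖z‖ = 1 := by
    have := congrArg norm h2
    simpa using this
  have : ‖a‖ < 1 := ha
  nlinarith [norm_nonneg a, norm_nonneg z]

lemma mb_one_sub {a z : ℂ} (ha : a ∈ unitDisc) (hz : ‖z‖ ≤ 1) :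
    1 - normSq (mb a z) = (1 - normSq a) * (1 - normSq z) / normSq (1 + (starRingEnd ℂ) a * z) := by
  unfold mb
  have h := (normSq_pos.2 (mb_den ha hz)).ne'
  rw [normSq_div]
  rw [eq_div_iff h, sub_mul, div_mul_cancel₀ _ h]
  simp [normSq_apply]; ring

lemma mb_sub {a z w : ℂ} (ha : a ∈ unitDisc) (hz : ‖z‖ ≤ 1) (hw : ‖w‖ ≤ 1) :
    mb a z - mb a w = (1 - normSq a) * (z - w) /
      ((1 + (starRingEnd ℂ) a * z) * (1 + (starRingEnd ℂ) a * w)) := by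
  unfold mb
  have h1 := mb_den ha hz
  have h2 := mb_den ha hw
  rw [normSq_eq_conj_mul_self, div_sub_div _ _ h1 h2]
  congr 1
  ring

lemma mb_mem {a z : ℂ} (ha : a ∈ unitDisc) (hz : z ∈ unitDisc) : mb a z ∈ unitDisc := by
  have h := mb_one_sub ha (le_of_lt hz : ‖z‖ ≤ 1)
  have h' := normSq_pos.2 (mb_den ha (le_of_lt hz : ‖z‖ ≤ 1))
  rw [mem_iff] at *
  have : 0 < 1 - normSq (mb a z) := by
    rw [h]
    exact div_pos (mul_pos (by linarith) (by linarith)) h'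
  linarith

lemma mb_dl {a z w : ℂ} (ha : a ∈ unitDisc) (hz : z ∈ unitDisc) (hw : w ∈ unitDisc) :
    dl (mb a z) (mb a w) = dl z w := by
  have hz' := (le_of_lt hz : ‖z‖ ≤ 1)
  have hw' := (le_of_lt hw : ‖w‖ ≤ 1)
  unfold dl
  rw [mb_sub ha hz' hw', mb_one_sub ha hz', mb_one_sub ha hw']
  have h1 := (normSq_pos.2 (mb_den ha hz'))
  have h2 := (normSq_pos.2 (mb_den ha hw'))
  rw [mem_iff] at *
  have h3 : 0 < (1 - normSq z) := by linarith
  have h4 : 0 < (1 - normSq w) := by linarith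
  have h5 : 0 < (1 - normSq a) := by linarith
  rw [normSq_div, normSq_mul, normSq_mul]
  have : normSq (1 - (normSq a : ℂ)) = (1 - normSq a) ^ 2 := by
    rw [← ofReal_one, ← ofReal_sub, normSq_ofReal]; ring
  rw [this]
  generalize normSq (1 + (starRingEnd ℂ) a * z) = A at *
  generalize normSq (1 + (starRingEnd ℂ) a * w) = B at *
  field_simp

lemma mb_pd {a z w : ℂ} (ha : a ∈ unitDisc) (hz : z ∈ unitDisc) (hw : w ∈ unitDisc) :
    pdist (mb a z) (mb a w) = pdist z w :=
  (pd_eq (mb_mem ha hz) (mb_mem ha hw) hz hw).2 (mb_dl ha hz hw)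

lemma neg_mem_disc {a : ℂ} (ha : a ∈ unitDisc) : -a ∈ unitDisc := by
  rw [mem_iff] at *; simpa using ha

lemma mb_inv {a z : ℂ} (ha : a ∈ unitDisc) (hz : z ∈ unitDisc) : mb a (mb (-a) z) = z := by
  have h1 := mb_den (neg_mem_disc ha) (le_of_lt hz : ‖z‖ ≤ 1)
  have h2 := mb_den ha (le_of_lt (mb_mem (neg_mem_disc ha) hz) : ‖_‖ ≤ 1)
  unfold mb at *
  rw [div_eq_iff h2]
  generalize hq : 1 + (starRingEnd ℂ) (-a) * z = q at *
  field_simp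
  rw [← hq]
  simp only [map_neg]
  ring

lemma mb_self {a : ℂ} : mb (-a) a = 0 := by simp [mb]
lemma mb_zero {a : ℂ} : mb a 0 = a := by simp [mb]

lemma rot_mem {e z : ℂ} (he : ‖e‖ = 1) (hz : z ∈ unitDisc) : e * z ∈ unitDisc := by
  unfold unitDisc at *; simpa [he] using hz

lemma rot_pd {e z w : ℂ} (he : ‖e‖ = 1) (hz : z ∈ unitDisc) (hw : w ∈ unitDisc) :
    pdist (e * z) (e * w) = pdist z w := by
  rw [pd_eq (rot_mem he hz) (rot_mem he hw) hz hw]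
  unfold dl
  rw [← mul_sub]
  simp [normSq_eq_norm_sq, he]

lemma pd_zero {z : ℂ} : pdist 0 z = artanh ‖z‖ := by simp [pdist]

lemma pd_tri {x y z : ℂ} (hx : x ∈ unitDisc) (hy : y ∈ unitDisc) (hz : z ∈ unitDisc) :
    pdist x z ≤ pdist x y + pdist y z := by
  have hy' := neg_mem_disc hy
  rw [← mb_pd hy' hx hz, ← mb_pd hy' hx hy, ← mb_pd hy' hy hz, mb_self]
  generalize h : mb (-y) x = X
  generalize h' : mb (-y) z = Z
  have hX : X ∈ unitDisc := h ▸ mb_mem hy' hx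
  have hZ : Z ∈ unitDisc := h' ▸ mb_mem hy' hz
  rw [pd_comm hX zero_mem_disc, pd_zero, pd_zero]
  have hX' : ‖X‖ < 1 := hX
  have hZ' : ‖Z‖ < 1 := hZ
  have n1 := norm_nonneg X
  have n2 := norm_nonneg Z
  have e := pd_real (u := -‖X‖) (v := ‖Z‖) (by linarith) (by linarith) hZ'
  rw [artanh_neg] at e
  rw [add_comm, ← sub_neg_eq_add, ← e, pd_le hX hZ (ofReal_mem (by simpa using hX')) (ofReal_mem (by simpa using hZ'))]
  unfold dl
  rw [normSq_ofReal, normSq_ofReal, ← ofReal_sub, normSq_ofReal]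
  simp only [normSq_eq_norm_sq]
  have : ‖X - Z‖ ≤ ‖X‖ + ‖Z‖ := norm_sub_le _ _
  have h3 : 0 < (1 - ‖X‖ ^ 2) * (1 - ‖Z‖ ^ 2) := mul_pos (by nlinarith) (by nlinarith)
  rw [show (1 - -‖X‖ * -‖X‖) * (1 - ‖Z‖ * ‖Z‖) = (1 - ‖X‖ ^ 2) * (1 - ‖Z‖ ^ 2) by ring]
  apply div_le_div_of_nonneg_right _ h3.le
  nlinarith [norm_nonneg (X - Z)]

/-- Maps of the disc that are Lipschitz and affine along geodesics. -/
def Geo (g : ℂ → ℂ) : Prop :=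
  (∀ z ∈ unitDisc, g z ∈ unitDisc) ∧
  (∃ L : ℝ, 0 ≤ L ∧ ∀ z ∈ unitDisc, ∀ w ∈ unitDisc, pdist (g z) (g w) ≤ L * pdist z w) ∧
  ∀ x ∈ unitDisc, ∀ y ∈ unitDisc, ∀ z ∈ unitDisc, pdist x y + pdist y z = pdist x z →
    pdist (g x) (g y) * pdist x z = pdist (g x) (g z) * pdist x y ∧
    pdist (g x) (g y) * pdist y z = pdist (g y) (g z) * pdist x y

lemma cs_eq {p : ℕ} (U V : Fin p → ℝ) (lam r s : ℝ) (hr : 0 ≤ r) (hs : 0 ≤ s)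
    (hU : ∑ j, U j ^ 2 = lam * r ^ 2) (hV : ∑ j, V j ^ 2 = lam * s ^ 2)
    (hUV : lam * r * s ≤ ∑ j, U j * V j) (j : Fin p) : U j * s = V j * r := by
  have h : ∑ j, (U j * s - V j * r) ^ 2 ≤ 0 := by
    have : ∑ j, (U j * s - V j * r) ^ 2 = s ^ 2 * ∑ j, U j ^ 2 + r ^ 2 * ∑ j, V j ^ 2
        - 2 * (r * s) * ∑ j, U j * V j := by
      rw [Finset.mul_sum, Finset.mul_sum, Finset.mul_sum, ← Finset.sum_add_distrib,
        ← Finset.sum_sub_distrib]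
      apply Finset.sum_congr rfl
      intros; ring
    rw [this, hU, hV]
    have := mul_le_mul_of_nonneg_left hUV (mul_nonneg hr hs)
    nlinarith
  have h2 := (Finset.sum_eq_zero_iff_of_nonneg (fun j _ => sq_nonneg (U j * s - V j * r))).1
    (le_antisymm h (Finset.sum_nonneg (fun j _ => sq_nonneg _))) j (Finset.mem_univ j)
  have := pow_eq_zero_iff (two_ne_zero) |>.1 h2
  linarith

lemma geo_of (p : ℕ) (lam : ℝ) (hlam : 0 < lam) (f : Fin p → ℂ → ℂ)
    (hmap : ∀ j, ∀ z ∈ unitDisc, f j z ∈ unitDisc)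
    (hsq : ∀ z ∈ unitDisc, ∀ w ∈ unitDisc,
      ∑ j, pdist (f j z) (f j w) ^ 2 = lam * pdist z w ^ 2) (j : Fin p) : Geo (f j) := by
  refine ⟨hmap j, ⟨Real.sqrt lam, Real.sqrt_nonneg _, ?_⟩, ?_⟩
  · intro z hz w hw
    apply le_of_sq_le_sq _ (mul_nonneg (Real.sqrt_nonneg _) (pd_nonneg hz hw))
    rw [mul_pow, Real.sq_sqrt hlam.le, ← hsq z hz w hw]
    exact Finset.single_le_sum (f := fun j => pdist (f j z) (f j w) ^ 2)
      (fun j _ => sq_nonneg _) (Finset.mem_univ j)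
  · intro x hx y hy z hz h
    have hr := pd_nonneg hx hy
    have hs := pd_nonneg hy hz
    have hU := hsq x hx y hy
    have hV := hsq y hy z hz
    have hW := hsq x hx z hz
    have U0 := fun j => pd_nonneg (hmap j x hx) (hmap j y hy)
    have V0 := fun j => pd_nonneg (hmap j y hy) (hmap j z hz)
    have W0 := fun j => pd_nonneg (hmap j x hx) (hmap j z hz)
    have T1 := fun j => pd_tri (hmap j x hx) (hmap j y hy) (hmap j z hz)
    have T2 := fun j => pd_tri (hmap j x hx) (hmap j z hz) (hmap j y hy)
    have T3 := fun j => pd_tri (hmap j y hy) (hmap j x hx) (hmap j z hz)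
    simp_rw [fun j => pd_comm (hmap j z hz) (hmap j y hy)] at T2
    simp_rw [fun j => pd_comm (hmap j y hy) (hmap j x hx)] at T3
    constructor
    · apply cs_eq (fun j => pdist (f j x) (f j y)) (fun j => pdist (f j x) (f j z)) lam _ _
        hr (pd_nonneg hx hz) hU hW
      have : ∑ j, pdist (f j x) (f j y) ^ 2 + ∑ j, pdist (f j x) (f j z) ^ 2
          - ∑ j, pdist (f j y) (f j z) ^ 2
          ≤ 2 * ∑ j, pdist (f j x) (f j y) * pdist (f j x) (f j z) := by
        rw [← Finset.sum_add_distrib, ← Finset.sum_sub_distrib, Finset.mul_sum]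
        apply Finset.sum_le_sum
        intro j _
        have := T1 j; have := T2 j; have := T3 j
        have := V0 j
        have : (pdist (f j x) (f j z) - pdist (f j x) (f j y)) ^ 2 ≤ pdist (f j y) (f j z) ^ 2 := by
          apply sq_le_sq'  <;> linarith
        linarith
      rw [hU, hV, hW, ← h] at this
      rw [← h]
      nlinarith
    · apply cs_eq (fun j => pdist (f j x) (f j y)) (fun j => pdist (f j y) (f j z)) lam _ _
        hr hs hU hV
      have : ∑ j, pdist (f j x) (f j z) ^ 2 - ∑ j, pdist (f j x) (f j y) ^ 2
          - ∑ j, pdist (f j y) (f j z) ^ 2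
          ≤ 2 * ∑ j, pdist (f j x) (f j y) * pdist (f j y) (f j z) := by
        rw [← Finset.sum_sub_distrib, ← Finset.sum_sub_distrib, Finset.mul_sum]
        apply Finset.sum_le_sum
        intro j _
        have := T1 j
        have := W0 j
        have : pdist (f j x) (f j z) ^ 2 ≤ (pdist (f j x) (f j y) + pdist (f j y) (f j z)) ^ 2 := by
          apply sq_le_sq'  <;> linarith [U0 j, V0 j]
        linarith
      rw [hU, hV, hW, ← h] at this
      nlinarith

lemma ge_mem {a e : ℂ} {u : ℝ} (ha : a ∈ unitDisc) (he : ‖e‖ = 1) (hu : -1 < u) (hu' : u < 1) :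
    mb a (e * u) ∈ unitDisc := mb_mem ha (rot_mem he (ofReal_mem (abs_lt.2 ⟨hu, hu'⟩)))

lemma ge_pd {a e : ℂ} {u v : ℝ} (ha : a ∈ unitDisc) (he : ‖e‖ = 1) (hu : -1 < u) (huv : u ≤ v)
    (hv : v < 1) : pdist (mb a (e * u)) (mb a (e * v)) = artanh v - artanh u := by
  have h1 := ofReal_mem (abs_lt.2 ⟨hu, (by linarith : u < 1)⟩)
  have h2 := ofReal_mem (abs_lt.2 ⟨(by linarith : -1 < v), hv⟩)
  rw [mb_pd ha (rot_mem he h1) (rot_mem he h2), rot_pd he h1 h2, pd_real hu huv hv]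

lemma ge_pd0 {a e : ℂ} {v : ℝ} (ha : a ∈ unitDisc) (he : ‖e‖ = 1) (h0 : 0 ≤ v)
    (hv : v < 1) : pdist a (mb a (e * v)) = artanh v := by
  have := ge_pd ha he (by norm_num) h0 hv
  simpa [mb_zero, artanh_zero] using this

lemma ge_ray {g : ℂ → ℂ} (hg : Geo g) {a e : ℂ} {u v : ℝ} (ha : a ∈ unitDisc) (he : ‖e‖ = 1)
    (hu : 0 ≤ u) (huv : u ≤ v) (hv : v < 1) :
    pdist (g a) (g (mb a (e * u))) * artanh v = pdist (g a) (g (mb a (e * v))) * artanh u := by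
  have h := (hg.2.2 a ha _ (ge_mem ha he (by linarith) (lt_of_le_of_lt huv hv)) _
    (ge_mem ha he (by linarith) hv))
  rw [ge_pd ha he (by linarith) huv hv, ge_pd0 ha he hu (by linarith),
    ge_pd0 ha he (by linarith) hv] at h
  exact (h (by ring)).1

/-- Speed of `g` along the geodesic from `a` in direction `e`. -/
def cc (g : ℂ → ℂ) (a e : ℂ) : ℝ := pdist (g a) (g (mb a (e * (1/2 : ℝ)))) / artanh (1/2)

lemma ah_pos : 0 < artanh (1/2) := by
  unfold artanh
  apply div_pos _ two_pos
  apply Real.log_pos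
  norm_num

lemma cc_spec {g : ℂ → ℂ} (hg : Geo g) {a e : ℂ} {u : ℝ} (ha : a ∈ unitDisc) (he : ‖e‖ = 1)
    (hu : 0 ≤ u) (hu' : u < 1) :
    pdist (g a) (g (mb a (e * u))) = cc g a e * artanh u := by
  have h : pdist (g a) (g (mb a (e * u))) * artanh (1/2) =
      pdist (g a) (g (mb a (e * (1/2 : ℝ)))) * artanh u := by
    rcases le_total u (1/2) with h | h
    · exact ge_ray hg ha he hu h (by norm_num)
    · exact (ge_ray hg ha he (by norm_num) h hu').symm
  unfold cc
  rw [div_mul_eq_mul_div, ← h, mul_div_cancel_right₀ _ ah_pos.ne']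

lemma cc_neg {g : ℂ → ℂ} (hg : Geo g) {a e : ℂ} (ha : a ∈ unitDisc) (he : ‖e‖ = 1) :
    cc g a (-e) = cc g a e := by
  have m1 := ge_mem (u := -(1/2)) ha he (by norm_num) (by norm_num)
  have m2 := ge_mem (u := 1/2) ha he (by norm_num) (by norm_num)
  have h := hg.2.2 _ m1 a ha _ m2
  have e1 : pdist (mb a (e * (-(1/2) : ℝ))) a = artanh (1/2) := by
    have := ge_pd (u := -(1/2)) (v := 0) ha he (by norm_num) (by norm_num) (by norm_num)
    rw [artanh_neg, artanh_zero] at this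
    simpa [mb_zero] using this
  have e2 := ge_pd (u := -(1/2)) (v := 1/2) ha he (by norm_num) (by norm_num) (by norm_num)
  rw [e2, e1, ge_pd0 ha he (by norm_num) (by norm_num), artanh_neg] at h
  have h' := mul_right_cancel₀ ah_pos.ne' (h (by ring)).2
  rw [pd_comm (hg.1 _ m1) (hg.1 _ ha)] at h'
  unfold cc
  rw [← h', show -e * ((1/2 : ℝ) : ℂ) = e * ((-(1/2) : ℝ) : ℂ) by push_cast; ring]

lemma artanh_surj {T : ℝ} (hT : 0 ≤ T) : ∃ u, 0 ≤ u ∧ u < 1 ∧ artanh u = T := by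
  have h1 : 1 ≤ Real.exp (2 * T) := Real.one_le_exp (by linarith)
  refine ⟨(Real.exp (2 * T) - 1) / (Real.exp (2 * T) + 1), ?_, ?_, ?_⟩
  · apply div_nonneg <;> linarith
  · rw [div_lt_one (by linarith)]; linarith
  · unfold artanh
    have : (1 + (Real.exp (2 * T) - 1) / (Real.exp (2 * T) + 1)) /
        (1 - (Real.exp (2 * T) - 1) / (Real.exp (2 * T) + 1)) = Real.exp (2 * T) := by
      have h2 : Real.exp (2 * T) + 1 ≠ 0 := by linarith
      rw [div_eq_iff]
      · field_simp; ring
      · field_simp; norm_num; exact h2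
    rw [this, Real.log_exp]; ring

lemma mb_bd {a e : ℂ} (ha : a ∈ unitDisc) (he : ‖e‖ = 1) : ‖mb a e‖ = 1 := by
  have := mb_one_sub ha he.le
  rw [normSq_eq_norm_sq e, he] at this
  simp only [one_pow, sub_self, mul_zero, zero_div] at this
  rw [normSq_eq_norm_sq] at this
  nlinarith [norm_nonneg (mb a e)]

lemma asymp {a e : ℂ} (ha : a ∈ unitDisc) (he : ‖e‖ = 1) :
    ∃ K : ℝ, ∀ u : ℝ, 0 ≤ u → u < 1 → pdist (mb a (e * u)) (mb a e * u) ≤ K := by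
  have ha' : ‖a‖ < 1 := ha
  have n0 := norm_nonneg a
  have ha2 : 0 < 1 - normSq a := by rw [mem_iff] at ha; linarith
  set K0 := 1 / (1 - ‖a‖) ^ 2 with hK0
  have hK0p : 0 ≤ K0 := by positivity
  set Q := 4 * (K0 + 1) ^ 2 / (1 - normSq a) with hQ
  have hQp : 0 ≤ Q := by positivity
  refine ⟨Real.cosh (1 + 2 * Q), ?_⟩
  intro u hu hu1
  have m1 := ge_mem ha he (by linarith) hu1
  have m2 : mb a e * u ∈ unitDisc :=
    rot_mem (mb_bd ha he) (ofReal_mem (abs_lt.2 ⟨by linarith, hu1⟩))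
  have hn : ‖e * u‖ = u := by simp [he, abs_of_nonneg hu]
  have hd : dl (mb a (e * u)) (mb a e * u) ≤ Q := by
    unfold dl
    have s1 := mb_one_sub (z := e * u) ha (by linarith)
    have s2 : normSq (mb a e * u) = u ^ 2 := by
      rw [normSq_mul, normSq_eq_norm_sq, mb_bd ha he, normSq_ofReal]; ring
    have lower : ∀ z : ℂ, ‖z‖ ≤ 1 → 1 - ‖a‖ ≤ ‖1 + (starRingEnd ℂ) a * z‖ := by
      intro z hz
      have := norm_sub_norm_le (1 : ℂ) (-((starRingEnd ℂ) a * z))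
      rw [sub_neg_eq_add] at this
      simp only [norm_one, norm_neg, norm_mul, RCLike.norm_conj] at this
      nlinarith [norm_nonneg z]
    have l1 := lower (e * u) (by linarith)
    have l2 := lower e he.le
    have up : ‖1 + (starRingEnd ℂ) a * (e * u)‖ ≤ 2 := by
      refine (norm_add_le _ _).trans ?_
      rw [norm_mul, hn, RCLike.norm_conj, norm_one]
      nlinarith
    have hp1 : 0 < ‖1 + (starRingEnd ℂ) a * (e * u)‖ := by linarith
    have b1 : ‖mb a (e * u) - mb a e‖ ≤ K0 * (1 - u) := by
      rw [mb_sub ha (by linarith) he.le, norm_div, norm_mul, norm_mul]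
      have q1 : ‖e * (u : ℂ) - e‖ = 1 - u := by
        rw [← mul_sub_one, norm_mul, he, one_mul, ← ofReal_one, ← ofReal_sub, norm_real,
          Real.norm_eq_abs, abs_of_nonpos (by linarith)]; ring
      have q2 : ‖(1 : ℂ) - (normSq a : ℂ)‖ ≤ 1 := by
        rw [← ofReal_one, ← ofReal_sub, norm_real, Real.norm_eq_abs, abs_of_pos ha2]
        linarith [normSq_nonneg a]
      rw [q1, hK0, one_div, ← div_eq_inv_mul]
      apply div_le_div₀ (by linarith) _ (by nlinarith) (by nlinarith)
      nlinarith
    have b2 : ‖mb a (e * u) - mb a e * u‖ ≤ (K0 + 1) * (1 - u) := by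
      have : mb a (e * u) - mb a e * u = (mb a (e * u) - mb a e) + mb a e * ((1 - u : ℝ) : ℂ) := by
        push_cast; ring
      rw [this]
      refine (norm_add_le _ _).trans ?_
      rw [norm_mul, mb_bd ha he, norm_real, Real.norm_eq_abs, abs_of_pos (by linarith)]
      linarith
    have b3 : (1 - normSq a) * (1 - u ^ 2) / 4 ≤ 1 - normSq (mb a (e * u)) := by
      rw [s1, normSq_eq_norm_sq (e * u), hn, normSq_eq_norm_sq (1 + _)]
      apply div_le_div_of_nonneg_left
      · apply mul_nonneg ha2.le; nlinarith
      · positivity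
      · nlinarith
    have hu2 : 0 < 1 - u ^ 2 := by nlinarith
    have pos : 0 < (1 - normSq a) * (1 - u ^ 2) / 4 := by positivity
    rw [s2, div_le_iff₀ (mul_pos (by linarith) hu2), normSq_eq_norm_sq]
    calc ‖mb a (e * u) - mb a e * u‖ ^ 2 ≤ ((K0 + 1) * (1 - u)) ^ 2 :=
          pow_le_pow_left₀ (norm_nonneg _) b2 2
      _ ≤ (K0 + 1) ^ 2 * (1 - u ^ 2) ^ 2 := by
          rw [mul_pow]
          apply mul_le_mul_of_nonneg_left _ (by positivity)
          apply pow_le_pow_left₀ (by linarith); nlinarith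
      _ = Q * ((1 - normSq a) * (1 - u ^ 2) / 4 * (1 - u ^ 2)) := by
          rw [hQ]; field_simp
      _ ≤ _ := by
          apply mul_le_mul_of_nonneg_left _ hQp
          exact mul_le_mul_of_nonneg_right b3 hu2.le
  have hc := pd_cosh m1 m2
  have h0 := pd_nonneg m1 m2
  have h1 : ∀ x : ℝ, 0 ≤ x → x ≤ Real.cosh x := by
    intro x hx
    rw [Real.cosh_eq]
    have := Real.quadratic_le_exp_of_nonneg hx
    have := Real.exp_pos (-x)
    nlinarith [Real.add_one_le_exp (-x)]
  have := h1 _ (by linarith : 0 ≤ 2 * pdist (mb a (e * u)) (mb a e * u))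
  have := h1 (1 + 2 * Q) (by linarith)
  linarith

lemma eq_of_bdd {x K : ℝ} (h : ∀ T : ℝ, 0 ≤ T → x * T ≤ K) : x ≤ 0 := by
  by_contra hx
  push Not at hx
  have h1 := h ((|K| + 1) / x) (by positivity)
  rw [mul_div_cancel₀ _ hx.ne'] at h1
  linarith [le_abs_self K]

lemma cc_asymp {g : ℂ → ℂ} (hg : Geo g) {a e : ℂ} (ha : a ∈ unitDisc) (he : ‖e‖ = 1) :
    cc g a e = cc g 0 (mb a e) := by
  obtain ⟨K, hK⟩ := asymp ha he
  obtain ⟨L, hL0, hL⟩ := hg.2.1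
  have main : ∀ T : ℝ, 0 ≤ T →
      |cc g a e * T - cc g 0 (mb a e) * T| ≤ pdist (g a) (g 0) + L * K := by
    intro T hT
    obtain ⟨u, hu, hu1, rfl⟩ := artanh_surj hT
    have m1 := ge_mem ha he (by linarith) hu1
    have m2 : mb a e * u ∈ unitDisc :=
      rot_mem (mb_bd ha he) (ofReal_mem (abs_lt.2 ⟨by linarith, hu1⟩))
    have h2 := cc_spec hg zero_mem_disc (mb_bd ha he) hu hu1
    rw [show mb 0 (mb a e * u) = mb a e * u by simp [mb]] at h2
    rw [← cc_spec hg ha he hu hu1, ← h2]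
    have h3 := (hL _ m1 _ m2).trans (mul_le_mul_of_nonneg_left (hK u hu hu1) hL0)
    have g1 := hg.1 _ m1
    have g2 := hg.1 _ m2
    have ga := hg.1 _ ha
    have g0 := hg.1 _ zero_mem_disc
    have t1 := pd_tri ga g0 g1
    have t2 := pd_tri g0 g2 g1
    have t3 := pd_tri g0 ga g2
    have t4 := pd_tri ga g1 g2
    rw [pd_comm g2 g1] at t2
    rw [pd_comm g0 ga] at t3
    rw [abs_le]; constructor <;> linarith
  apply le_antisymm
  · have := eq_of_bdd (x := cc g a e - cc g 0 (mb a e)) (fun T hT => by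
      rw [sub_mul]; exact (le_abs_self _).trans (main T hT))
    linarith
  · have := eq_of_bdd (x := cc g 0 (mb a e) - cc g a e) (fun T hT => by
      rw [sub_mul]; have := main T hT; rw [abs_sub_comm] at this; exact (le_abs_self _).trans this)
    linarith

lemma cc_bd_aux {g : ℂ → ℂ} (hg : Geo g) {w : ℂ} (hw : ‖w‖ = 1) (him : 0 < w.im) :
    cc g 0 (w * w) = cc g 0 1 := by
  set t := w.re / (1 + w.im) with ht
  have hn : w.re * w.re + w.im * w.im = 1 := by
    rw [← normSq_apply, normSq_eq_norm_sq, hw]; norm_num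
  have ht1 : |t| < 1 := by
    rw [← sq_lt_one_iff_abs_lt_one, ht, div_pow, div_lt_one (by positivity)]
    nlinarith
  have htm : t * (1 + w.im) = w.re := by rw [ht]; field_simp
  have ha : w * t ∈ unitDisc := rot_mem hw (ofReal_mem ht1)
  have he : ‖w * I‖ = 1 := by simp [hw]
  have hcw : (starRingEnd ℂ) w * w = 1 := by
    rw [← normSq_eq_conj_mul_self, normSq_eq_norm_sq, hw]; norm_num
  have k1 : (t + I : ℂ) = w * (1 + t * I) := by
    apply Complex.ext
    · simp; linarith
    · simp; rw [← mul_left_inj' (by linarith : 1 + w.im ≠ 0)]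
      linear_combination - hn - w.re * htm
  have k2 : (t - I : ℂ) = (starRingEnd ℂ) w * (1 - t * I) := by
    have := congrArg (starRingEnd ℂ) k1
    simpa [sub_eq_add_neg] using this
  have e1 : mb (w * t) (w * I) = w * w := by
    have hd := mb_den ha he.le
    unfold mb
    rw [div_eq_iff hd, map_mul, conj_ofReal]
    linear_combination w * k1 - w * w * t * I * hcw
  have he' : ‖-(w * I)‖ = 1 := by rw [norm_neg, he]
  have e2 : mb (w * t) (-(w * I)) = 1 := by
    have hd := mb_den ha he'.le
    unfold mb
    rw [div_eq_iff hd, map_mul, conj_ofReal]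
    linear_combination w * k2 + hcw
  rw [← e1, ← cc_asymp hg ha he, ← cc_neg hg ha he, cc_asymp hg ha he', e2]

lemma cc_bd {g : ℂ → ℂ} (hg : Geo g) {x : ℂ} (hx : ‖x‖ = 1) :
    cc g 0 x = cc g 0 1 := by
  obtain ⟨w, rfl⟩ := IsAlgClosed.exists_eq_mul_self x
  have hw : ‖w‖ = 1 := by
    rw [norm_mul] at hx; nlinarith [norm_nonneg w]
  rcases lt_trichotomy w.im 0 with h | h | h
  · have := cc_bd_aux hg (w := -w) (by simpa using hw) (by simpa using h)
    simpa using this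
  · have : w * w = 1 := by
      have hn : w.re * w.re + w.im * w.im = 1 := by
        rw [← normSq_apply, normSq_eq_norm_sq, hw]; norm_num
      apply Complex.ext
      · simp [h]; nlinarith
      · simp [h]
    rw [this]
  · exact cc_bd_aux hg hw h

lemma pd_self {z : ℂ} : pdist z z = 0 := by simp [pdist, artanh]

lemma geo_scale {g : ℂ → ℂ} (hg : Geo g) : ∃ c : ℝ, 0 ≤ c ∧
    ∀ z ∈ unitDisc, ∀ w ∈ unitDisc, pdist (g z) (g w) = c * pdist z w := by
  refine ⟨cc g 0 1, ?_, ?_⟩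
  · apply div_nonneg _ ah_pos.le
    apply pd_nonneg (hg.1 _ zero_mem_disc) (hg.1 _ (ge_mem zero_mem_disc (by simp) (by norm_num) (by norm_num)))
  · intro z hz w hw
    have hv := mb_mem (neg_mem_disc hz) hw
    have hi := mb_inv hz hw
    generalize mb (-z) w = v at hv hi
    by_cases h0 : v = 0
    · rw [h0, mb_zero] at hi
      rw [hi, pd_self, pd_self, mul_zero]
    · have hn : ‖v‖ ≠ 0 := norm_ne_zero_iff.2 h0
      have he : ‖v / ‖v‖‖ = 1 := by simp [hn]
      have : v = v / ‖v‖ * (‖v‖ : ℝ) := by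
        have : (‖v‖ : ℂ) ≠ 0 := by exact_mod_cast hn
        field_simp
      rw [this] at hi
      rw [← hi, cc_spec hg hz he (norm_nonneg v) hv, ge_pd0 hz he (norm_nonneg v) hv,
        cc_asymp hg hz he, cc_bd hg (mb_bd hz he)]

/-- Compatibility of scaling by `c` with the hyperbolic Pythagoras theorem. -/
def Pyth (c : ℝ) : Prop := ∀ x : ℝ, 0 ≤ x → ∃ y : ℝ, 0 ≤ y ∧
  Real.cosh y = Real.cosh x ^ 2 ∧ Real.cosh (c * y) = Real.cosh (c * x) ^ 2

lemma pyth_inv {c : ℝ} (hc : 0 < c) (h : Pyth c) : Pyth c⁻¹ := by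
  intro x hx
  obtain ⟨y, hy, h1, h2⟩ := h (c⁻¹ * x) (by positivity)
  refine ⟨c * y, by positivity, ?_, ?_⟩
  · rw [h2, mul_inv_cancel_left₀ hc.ne']
  · rw [inv_mul_cancel_left₀ hc.ne', h1]

lemma cosh_aux {x y : ℝ} (hx : 0 ≤ x) (hy : 0 ≤ y) (h : Real.cosh y = Real.cosh x ^ 2) :
    Real.exp (2 * x) / 2 ≤ Real.exp y ∧ Real.exp y ≤ Real.exp (2 * x) / 2 + 2 := by
  rw [Real.cosh_eq, Real.cosh_eq] at h
  have e1 : Real.exp (2 * x) = Real.exp x ^ 2 := by rw [← Real.exp_nat_mul]; norm_num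
  have e2 : Real.exp x * Real.exp (-x) = 1 := by rw [← Real.exp_add]; simp
  have e3 : Real.exp (-y) ≤ 1 := by simpa using hy
  have e4 : Real.exp (-x) ≤ 1 := by simpa using hx
  have e5 := Real.exp_pos (-x)
  have e6 := Real.exp_pos (-y)
  rw [e1]
  constructor <;> nlinarith

lemma pyth_ge {c : ℝ} (hc : 0 < c) (h : Pyth c) : 1 ≤ c := by
  have key : Real.exp (-(c * Real.log 2)) - 1 / 2 ≤ 0 := by
    apply eq_of_bdd (K := 2)
    intro T hT
    obtain ⟨y, hy, h1, h2⟩ := h (T / (2 * c)) (by positivity)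
    have a1 := (cosh_aux (by positivity) hy h1).1
    have a2 := (cosh_aux (by positivity) (by positivity) h2).2
    rw [show 2 * (c * (T / (2 * c))) = T by field_simp] at a2
    have a3 : 2 * (T / (2 * c)) - Real.log 2 ≤ y := by
      rw [← Real.exp_le_exp, Real.exp_sub, Real.exp_log two_pos]; exact a1
    have a4 : T - c * Real.log 2 ≤ c * y := by
      have := mul_le_mul_of_nonneg_left a3 hc.le
      rw [mul_sub, show c * (2 * (T / (2 * c))) = T by field_simp] at this
      exact this
    have a5 := (Real.exp_le_exp.2 a4).trans a2
    rw [sub_eq_add_neg, Real.exp_add] at a5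
    have a6 := Real.add_one_le_exp T
    generalize Real.exp (-(c * Real.log 2)) = q at *
    have a7 : Real.exp T * (q - 1/2) ≤ 2 := by linarith
    rcases le_total 0 (q - 1/2) with h | h
    · nlinarith
    · nlinarith
  have h2 : Real.exp (-(c * Real.log 2)) ≤ Real.exp (-(Real.log 2)) := by
    rw [Real.exp_neg (Real.log 2), Real.exp_log two_pos]; linarith
  rw [Real.exp_le_exp] at h2
  have := Real.log_pos (one_lt_two)
  nlinarith

lemma pyth_one {c : ℝ} (hc : 0 < c) (h : Pyth c) : c = 1 := by
  apply le_antisymm _ (pyth_ge hc h)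
  have := pyth_ge (inv_pos.2 hc) (pyth_inv hc h)
  exact (one_le_inv₀ hc).1 this

lemma dl_zero (z : ℂ) : dl 0 z = normSq z / (1 - normSq z) := by simp [dl]

lemma dl_zero_inj {z w : ℂ} (hz : z ∈ unitDisc) (hw : w ∈ unitDisc) (h : dl 0 z = dl 0 w) :
    normSq z = normSq w := by
  rw [mem_iff] at hz hw
  rw [dl_zero, dl_zero, div_eq_div_iff (by linarith) (by linarith)] at h
  linarith

lemma scale_pyth {g : ℂ → ℂ} {c : ℝ} (hc : 0 < c) (hg : ∀ z ∈ unitDisc, g z ∈ unitDisc)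
    (hs : ∀ z ∈ unitDisc, ∀ w ∈ unitDisc, pdist (g z) (g w) = c * pdist z w) (h0 : g 0 = 0) :
    Pyth c := by
  intro x hx
  obtain ⟨r, hr, hr1, hrx⟩ := artanh_surj (T := x / 2) (by linarith)
  have mr : (r : ℂ) ∈ unitDisc := ofReal_mem (abs_lt.2 ⟨by linarith, hr1⟩)
  have mr' : -(r : ℂ) ∈ unitDisc := neg_mem_disc mr
  have mi : I * (r : ℂ) ∈ unitDisc := rot_mem (by simp) mr
  have nr : normSq (r : ℂ) = r ^ 2 := by rw [normSq_ofReal]; ring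
  have nr' : normSq (-(r : ℂ)) = r ^ 2 := by rw [normSq_neg, nr]
  have ni : normSq (I * (r : ℂ)) = r ^ 2 := by rw [normSq_mul, nr]; simp
  have hr2 : 0 < 1 - r ^ 2 := by nlinarith
  have p1 : pdist 0 (r : ℂ) = x / 2 := by rw [pd_zero]; simp [abs_of_nonneg hr, hrx]
  have p2 : pdist 0 (-(r : ℂ)) = x / 2 := by rw [pd_zero]; simp [abs_of_nonneg hr, hrx]
  have p3 : pdist 0 (I * (r : ℂ)) = x / 2 := by rw [pd_zero]; simp [abs_of_nonneg hr, hrx]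
  have p4 : pdist (-(r : ℂ)) (r : ℂ) = x := by
    have := pd_real (u := -r) (v := r) (by linarith) (by linarith) hr1
    rw [artanh_neg, hrx] at this
    push_cast at this
    rw [this]; ring
  have p5 : pdist (-(r : ℂ)) (I * r) = pdist (r : ℂ) (I * r) := by
    rw [pd_eq mr' mi mr mi]
    unfold dl
    rw [nr, nr', ni]
    congr 1
    simp [normSq_apply]
  have cx : Real.cosh x = 1 + 2 * (r ^ 2 / (1 - r ^ 2)) := by
    have := pd_cosh zero_mem_disc mr
    rw [p1, dl_zero, nr] at this
    rw [← this]; congr 1; ring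
  have cy := pd_cosh mr mi
  have dy : dl (r : ℂ) (I * r) = 2 * r ^ 2 / (1 - r ^ 2) ^ 2 := by
    unfold dl
    rw [nr, ni]
    congr 1
    · simp [normSq_apply]; ring
    · ring
  have A := hg _ mr
  have A' := hg _ mr'
  have B := hg _ mi
  have s1 := hs _ zero_mem_disc _ mr
  have s2 := hs _ zero_mem_disc _ mr'
  have s3 := hs _ zero_mem_disc _ mi
  have s4 := hs _ mr' _ mr
  have s5 := hs _ mr' _ mi
  have s6 := hs _ mr _ mi
  rw [h0] at s1 s2 s3
  rw [p1] at s1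
  rw [p2] at s2
  rw [p3] at s3
  rw [p4] at s4
  rw [p5] at s5
  refine ⟨2 * pdist (r : ℂ) (I * r), ?_, ?_, ?_⟩
  · have := pd_nonneg mr mi; linarith
  · rw [cy, cx, dy]; field_simp; ring
  · have n1 := dl_zero_inj A' A ((pd_eq zero_mem_disc A' zero_mem_disc A).1 (by rw [s1, s2]))
    have n2 := dl_zero_inj B A ((pd_eq zero_mem_disc B zero_mem_disc A).1 (by rw [s1, s3]))
    have e5 := (pd_eq A' B A B).1 (by rw [s5, s6])
    have c1 := pd_cosh zero_mem_disc A
    have c4 := pd_cosh A' A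
    have c6 := pd_cosh A B
    rw [s1, dl_zero, show 2 * (c * (x / 2)) = c * x by ring] at c1
    rw [s4, Real.cosh_two_mul, Real.sinh_sq, c1] at c4
    rw [s6] at c6
    unfold dl at c4 c6 e5
    rw [n1, n2] at e5
    rw [n1] at c4
    rw [n2] at c6
    rw [mem_iff] at A
    generalize g r = a at *
    generalize g (-r) = a' at *
    generalize g (I * r) = b at *
    have hq : 0 < 1 - normSq a := by linarith
    have f4 : normSq (a' - a) = 4 * normSq a := by
      generalize normSq (a' - a) = m at *
      generalize normSq a = q at *
      field_simp at c4
      nlinarith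
    have f5 : normSq (a' - b) = normSq (a - b) := by
      generalize normSq (a' - b) = m at *
      generalize normSq (a - b) = m' at *
      field_simp at e5
      exact e5
    have f6 : a' = -a := by
      have : normSq (a' + a) = 0 := by
        simp only [normSq_apply, sub_re, sub_im, add_re, add_im] at *
        linarith
      rw [normSq_eq_zero] at this
      linear_combination this
    have f7 : normSq (a - b) = 2 * normSq a := by
      rw [f6] at f5
      simp only [normSq_apply, sub_re, sub_im, neg_re, neg_im] at *
      linarith
    rw [f7] at c6
    rw [show c * (2 * pdist (r : ℂ) (I * r)) = 2 * (c * pdist (r : ℂ) (I * r)) by ring, c6, c1]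
    generalize normSq a = q at *
    field_simp
    ring

lemma isom_zero {g : ℂ → ℂ} (hg : ∀ z ∈ unitDisc, g z ∈ unitDisc)
    (hs : ∀ z ∈ unitDisc, ∀ w ∈ unitDisc, pdist (g z) (g w) = pdist z w) (h0 : g 0 = 0) :
    ∃ e : ℂ, ‖e‖ = 1 ∧ ((∀ z ∈ unitDisc, g z = e * z) ∨
      (∀ z ∈ unitDisc, g z = e * (starRingEnd ℂ) z)) := by
  have hn : ∀ z ∈ unitDisc, normSq (g z) = normSq z := by
    intro z hz
    apply dl_zero_inj (hg z hz) hz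
    rw [← pd_eq zero_mem_disc (hg z hz) zero_mem_disc hz, ← hs _ zero_mem_disc z hz, h0]
  have hi : ∀ z ∈ unitDisc, ∀ w ∈ unitDisc, (g z).re * (g w).re + (g z).im * (g w).im =
      z.re * w.re + z.im * w.im := by
    intro z hz w hw
    have h := (pd_eq (hg z hz) (hg w hw) hz hw).1 (hs z hz w hw)
    unfold dl at h
    have n1 := hn z hz
    have n2 := hn w hw
    rw [n1, n2] at h
    rw [mem_iff] at hz hw
    have a1 : 1 - normSq z ≠ 0 := by linarith
    have a2 : 1 - normSq w ≠ 0 := by linarith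
    rw [div_left_inj' (mul_ne_zero a1 a2)] at h
    simp only [normSq_apply, sub_re, sub_im] at *
    linarith
  have mh : ((1/2 : ℝ) : ℂ) ∈ unitDisc := ofReal_mem (by rw [abs_of_pos] <;> norm_num)
  have mi : I * ((1/2 : ℝ) : ℂ) ∈ unitDisc := rot_mem (by simp) mh
  set a := g ((1/2 : ℝ) : ℂ) with ha
  set b := g (I * ((1/2 : ℝ) : ℂ)) with hb
  have a2 : a.re * a.re + a.im * a.im = 1/4 := by
    have := hi _ mh _ mh
    rw [← ha] at this
    simp at this; linarith
  have b2 : b.re * b.re + b.im * b.im = 1/4 := by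
    have := hi _ mi _ mi
    rw [← hb] at this
    simp at this; linarith
  have ab : a.re * b.re + a.im * b.im = 0 := by
    have := hi _ mh _ mi
    rw [← hb, ← ha] at this
    simp at this; linarith
  have za : ∀ z ∈ unitDisc, (g z).re * a.re + (g z).im * a.im = z.re / 2 := by
    intro z hz
    have := hi _ hz _ mh
    rw [← ha] at this
    simp at this; linarith
  have zb : ∀ z ∈ unitDisc, (g z).re * b.re + (g z).im * b.im = z.im / 2 := by
    intro z hz
    have := hi _ hz _ mi
    rw [← hb] at this
    simp at this; linarith
  have hbs : (b.re = -a.im ∧ b.im = a.re) ∨ (b.re = a.im ∧ b.im = -a.re) := by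
    have : (a.re * b.im - a.im * b.re) ^ 2 = (1/4) ^ 2 := by
      nlinarith
    rcases sq_eq_sq_iff_eq_or_eq_neg.1 this with h | h
    · left; constructor
      · linear_combination 4 * a.re * ab - 4 * a.im * h - 4 * b.re * a2
      · linear_combination 4 * a.im * ab + 4 * a.re * h - 4 * b.im * a2
    · right; constructor
      · linear_combination 4 * a.re * ab - 4 * a.im * h - 4 * b.re * a2
      · linear_combination 4 * a.im * ab + 4 * a.re * h - 4 * b.im * a2
  refine ⟨2 * a, ?_, ?_⟩
  · have : ‖a‖ ^ 2 = 1/4 := by rw [← normSq_eq_norm_sq, normSq_apply, a2]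
    rw [norm_mul]
    simp only [Complex.norm_ofNat]
    nlinarith [norm_nonneg a]
  · rcases hbs with ⟨h1, h2⟩ | ⟨h1, h2⟩
    · left
      intro z hz
      have p := za z hz
      have q := zb z hz
      rw [h1, h2] at q
      apply Complex.ext
      · simp
        linear_combination 4 * a.re * p - 4 * a.im * q - 4 * (g z).re * a2
      · simp
        linear_combination 4 * a.im * p + 4 * a.re * q - 4 * (g z).im * a2
    · right
      intro z hz
      have p := za z hz
      have q := zb z hz
      rw [h1, h2] at q
      apply Complex.ext
      · simp
        linear_combination 4 * a.re * p + 4 * a.im * q - 4 * (g z).re * a2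
      · simp
        linear_combination 4 * a.im * p - 4 * a.re * q - 4 * (g z).im * a2

lemma mobius_of {f : ℂ → ℂ} {b e : ℂ} (hb : b ∈ unitDisc) (he : ‖e‖ = 1)
    (h : ∀ z ∈ unitDisc, f z = mb b (e * z)) : IsMobiusOn f := by
  have hce : (starRingEnd ℂ) e * e = 1 := by
    rw [← normSq_eq_conj_mul_self, normSq_eq_norm_sq, he]; norm_num
  refine ⟨arg e, -((starRingEnd ℂ) e * b), ?_, ?_⟩
  · rw [norm_neg, norm_mul, RCLike.norm_conj, he, one_mul]; exact hb
  · intro z hz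
    have h1 : exp (arg e * I) = e := by
      have := norm_mul_exp_arg_mul_I e
      rw [he] at this
      simpa using this
    rw [h z hz, h1]
    unfold mb
    rw [← mul_div_assoc]
    congr 1
    · linear_combination -b * hce
    · simp only [map_neg, map_mul, conj_conj]; ring

lemma scale_cases {g : ℂ → ℂ} {c : ℝ} (hc : 0 ≤ c) (hg : ∀ z ∈ unitDisc, g z ∈ unitDisc)
    (hs : ∀ z ∈ unitDisc, ∀ w ∈ unitDisc, pdist (g z) (g w) = c * pdist z w) :
    (c = 0 ∧ ∃ k : ℂ, ∀ z ∈ unitDisc, g z = k) ∨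
    (c = 1 ∧ (IsMobiusOn g ∨ IsMobiusOn (fun z => (starRingEnd ℂ) (g z)))) := by
  have hb := hg 0 zero_mem_disc
  have hb' := neg_mem_disc hb
  rcases hc.eq_or_lt with rfl | hc
  · left
    refine ⟨rfl, g 0, ?_⟩
    intro z hz
    have h := hs z hz 0 zero_mem_disc
    rw [zero_mul, ← pd_self (z := (0 : ℂ)), pd_eq (hg z hz) hb zero_mem_disc zero_mem_disc] at h
    have hz' := hg z hz
    rw [mem_iff] at hz' hb
    unfold dl at h
    simp only [sub_self, map_zero, zero_div] at h
    rw [div_eq_zero_iff] at h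
    rcases h with h | h
    · rw [normSq_eq_zero, sub_eq_zero] at h; exact h
    · exact absurd h (mul_pos (by linarith) (by linarith)).ne'
  · right
    have G : ∀ z ∈ unitDisc, mb (-(g 0)) (g z) ∈ unitDisc := fun z hz => mb_mem hb' (hg z hz)
    have c1 : c = 1 := by
      apply pyth_one hc
      apply scale_pyth (g := fun z => mb (-(g 0)) (g z)) hc G _ mb_self
      intro z hz w hw
      rw [mb_pd hb' (hg z hz) (hg w hw), hs z hz w hw]
    refine ⟨c1, ?_⟩
    obtain ⟨e, he, h | h⟩ := isom_zero (g := fun z => mb (-(g 0)) (g z)) G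
      (by
        intro z hz w hw
        rw [mb_pd hb' (hg z hz) (hg w hw), hs z hz w hw, c1, one_mul]) mb_self
    · left
      apply mobius_of hb he
      intro z hz
      rw [← h z hz, mb_inv hb (hg z hz)]
    · right
      apply mobius_of (b := (starRingEnd ℂ) (g 0)) (e := (starRingEnd ℂ) e)
      · rw [mem_iff, normSq_conj, ← mem_iff]; exact hb
      · simpa using he
      · intro z hz
        rw [← mb_inv hb (hg z hz), h z hz]
        simp [mb]

/-- **Proposition 3.2.** A totally geodesic isometric embedding
`f : (Δ, λ g_Δ) → (Δ^p, g_{Δ^p})` extending `C¹` to the closed disc has `λ` components that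
are Möbius automorphisms or conjugates thereof, the remaining components being constant. -/
theorem totally_geodesic_disc_in_polydisc
    (p : ℕ) (hp : 0 < p) (lam : ℝ) (hlam : 0 < lam)
    (f : Fin p → ℂ → ℂ)
    (hmap : ∀ j, ∀ z ∈ unitDisc, f j z ∈ unitDisc)
    (hC1 : ∀ j, ContDiffOn ℝ 1 (f j) closedUnitDisc)
    (hiso : ∀ z ∈ unitDisc, ∀ w ∈ unitDisc,
      polyDist p (fun j => f j z) (fun j => f j w) = Real.sqrt lam * pdist z w) :
    ∃ k : ℕ, 0 < k ∧ (lam : ℝ) = (k : ℝ) ∧ k ≤ p ∧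
      ∃ S : Finset (Fin p), S.card = k ∧
        (∀ j ∈ S, IsMobiusOn (f j) ∨ IsMobiusOn (fun z => (starRingEnd ℂ) (f j z))) ∧
        (∀ j ∉ S, ∃ c : ℂ, ∀ z ∈ unitDisc, f j z = c) := by
  have hsq : ∀ z ∈ unitDisc, ∀ w ∈ unitDisc,
      ∑ j, pdist (f j z) (f j w) ^ 2 = lam * pdist z w ^ 2 := by
    intro z hz w hw
    have h := hiso z hz w hw
    unfold polyDist at h
    have h2 := congrArg (fun t => t ^ 2) h
    simp only at h2
    rw [Real.sq_sqrt (Finset.sum_nonneg (fun j _ => sq_nonneg _)), mul_pow,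
      Real.sq_sqrt hlam.le] at h2
    exact h2
  choose c hc0 hc using fun j => geo_scale (geo_of p lam hlam f hmap hsq j)
  have hcase := fun j => scale_cases (hc0 j) (hmap j) (hc j)
  classical
  set S : Finset (Fin p) := Finset.univ.filter (fun j => c j = 1) with hS
  have hl : lam = (S.card : ℝ) := by
    have mh : ((1/2 : ℝ) : ℂ) ∈ unitDisc := ofReal_mem (by rw [abs_of_pos] <;> norm_num)
    have h := hsq 0 zero_mem_disc _ mh
    have hpd : pdist 0 ((1/2 : ℝ) : ℂ) = artanh (1/2) := by
      rw [pd_zero, norm_real, Real.norm_eq_abs, abs_of_pos (by norm_num)]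
    simp_rw [fun j => hc j 0 zero_mem_disc _ mh, hpd, mul_pow] at h
    rw [← Finset.sum_mul] at h
    have h2 := mul_right_cancel₀ (pow_ne_zero 2 ah_pos.ne') h
    rw [← h2, hS, Finset.card_filter]
    push_cast
    apply Finset.sum_congr rfl
    intro j _
    rcases hcase j with ⟨h, _⟩ | ⟨h, _⟩ <;> simp [h]
  refine ⟨S.card, ?_, hl, ?_, S, rfl, ?_, ?_⟩
  · rw [hl] at hlam; exact_mod_cast hlam
  · simpa using Finset.card_le_univ S
  · intro j hj
    have hj1 : c j = 1 := (Finset.mem_filter.1 hj).2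
    rcases hcase j with ⟨h, _⟩ | ⟨_, h⟩
    · rw [h] at hj1; exact absurd hj1 zero_ne_one
    · exact h
  · intro j hj
    rcases hcase j with ⟨_, h⟩ | ⟨h, _⟩
    · exact h
    · exact absurd (Finset.mem_filter.2 ⟨Finset.mem_univ j, h⟩) hj
end
end

section
/- Let n ≤ m be positive integers, λ > 0 a real number, and let f : B^n → B^m be a C²-smooth map with d_{B^m}(f(z), f(w)) = √λ · d_{B^n}(z, w) for all z, w ∈ B^n. Suppose f extends C¹-smoothly to B^n ∪ U for some nonempty open subset U of the unit sphere ∂B^n, and the radial derivative of f is nonzero at every point of U. Then λ = 1 and there exists a biholomorphic automorphism Ψ of B^m such that either Ψ(f(z)) = (z₁, …, z_n, 0, …, 0) for all z ∈ B^n, or Ψ(f(z)) = (conj(z₁), …, conj(z_n), 0, …, 0) for all z ∈ B^n. -/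
open Complex Metric Set Filter

noncomputable section

/-- The Bergman (hyperbolic) distance on the unit ball `B^n ⊂ ℂ^n`. -/
def ballDist {n : ℕ} (z w : EuclideanSpace ℂ (Fin n)) : ℝ :=
  artanh (Real.sqrt
    (1 - (1 - ‖z‖ ^ 2) * (1 - ‖w‖ ^ 2) /
      ‖1 - ∑ j, z j * (starRingEnd ℂ) (w j)‖ ^ 2))

/-- `Ψ` is a biholomorphic automorphism of the unit ball `B^m`. -/
def IsBiholoAutBall (m : ℕ) (Ψ : EuclideanSpace ℂ (Fin m) → EuclideanSpace ℂ (Fin m)) : Prop :=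
  Set.MapsTo Ψ (Metric.ball 0 1) (Metric.ball 0 1) ∧
  DifferentiableOn ℂ Ψ (Metric.ball 0 1) ∧
  ∃ Φ : EuclideanSpace ℂ (Fin m) → EuclideanSpace ℂ (Fin m),
    Set.MapsTo Φ (Metric.ball 0 1) (Metric.ball 0 1) ∧
    DifferentiableOn ℂ Φ (Metric.ball 0 1) ∧
    (∀ z ∈ Metric.ball (0 : EuclideanSpace ℂ (Fin m)) 1, Φ (Ψ z) = z) ∧
    (∀ z ∈ Metric.ball (0 : EuclideanSpace ℂ (Fin m)) 1, Ψ (Φ z) = z)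

/-- The standard linear inclusion `ℂ^n → ℂ^m`, `z ↦ (z₁, …, z_n, 0, …, 0)`. -/
def inclBall (n m : ℕ) (z : EuclideanSpace ℂ (Fin n)) : EuclideanSpace ℂ (Fin m) :=
  WithLp.toLp 2 fun j => if h : (j : ℕ) < n then z ⟨j, h⟩ else 0

/-- Componentwise complex conjugation on `ℂ^n`. -/
def conjVec (n : ℕ) (z : EuclideanSpace ℂ (Fin n)) : EuclideanSpace ℂ (Fin n) :=
  WithLp.toLp 2 fun j => (starRingEnd ℂ) (z j)


lemma artanh_inj {x y : ℝ} (hx : -1 < x) (hx1 : x < 1) (hy : -1 < y) (hy1 : y < 1)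
    (h : artanh x = artanh y) : x = y := by
  unfold artanh at h
  have h1 : Real.log ((1 + x) / (1 - x)) = Real.log ((1 + y) / (1 - y)) := by linarith
  have h2 := Real.log_injOn_pos (Set.mem_Ioi.2 (div_pos (by linarith) (by linarith)))
    (Set.mem_Ioi.2 (div_pos (by linarith) (by linarith))) h1
  rw [div_eq_div_iff (by linarith) (by linarith)] at h2
  linarith

lemma artanh_sub {a b : ℝ} (ha : 0 ≤ a) (ha1 : a < 1) (hb : 0 ≤ b) (hb1 : b < 1) :
    artanh b - artanh a = artanh ((b - a) / (1 - a * b)) := by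
  have hab : a * b < 1 := by nlinarith
  unfold artanh
  have h1 : (1 + (b - a) / (1 - a * b)) / (1 - (b - a) / (1 - a * b))
      = ((1 + b) / (1 - b)) / ((1 + a) / (1 - a)) := by
    have e1 : 1 + (b - a) / (1 - a * b) = (1 + b) * (1 - a) / (1 - a * b) := by
      have : 1 - a * b ≠ 0 := by linarith
      have : 1 - b * a ≠ 0 := by linarith
      field_simp; ring
    have e2 : 1 - (b - a) / (1 - a * b) = (1 - b) * (1 + a) / (1 - a * b) := by
      have : 1 - a * b ≠ 0 := by linarith
      have : 1 - b * a ≠ 0 := by linarith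
      field_simp; ring
    rw [e1, e2]
    have : 1 - a * b ≠ 0 := by linarith
    have : 1 - b * a ≠ 0 := by linarith
    have : 1 - a ≠ 0 := by linarith
    have : 1 - b ≠ 0 := by linarith
    have : 1 + a ≠ 0 := by linarith
    field_simp
  rw [h1, Real.log_div (div_pos (by linarith) (by linarith)).ne'
    (div_pos (by linarith) (by linarith)).ne']
  ring

section Gen

variable {V : Type*} [NormedAddCommGroup V] [InnerProductSpace ℂ V]

def delta (z w : V) : ℝ :=
  1 - (1 - ‖z‖ ^ 2) * (1 - ‖w‖ ^ 2) / ‖1 - inner ℂ w z‖ ^ 2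

lemma ballDist_eq {n : ℕ} (z w : EuclideanSpace ℂ (Fin n)) :
    ballDist z w = artanh (Real.sqrt (delta z w)) := by
  unfold ballDist delta
  simp [PiLp.inner_apply]

lemma one_sub_inner_ge (z w : V) : 1 - ‖z‖ * ‖w‖ ≤ ‖1 - inner ℂ w z‖ := by
  have h1 := norm_sub_norm_le (1 : ℂ) (inner ℂ w z)
  have h2 := norm_inner_le_norm (𝕜 := ℂ) w z
  rw [norm_one] at h1
  linarith

lemma delta_nonneg {z w : V} (hz : ‖z‖ < 1) (hw : ‖w‖ < 1) : 0 ≤ delta z w := by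
  have h := one_sub_inner_ge z w
  have h0 : 0 < 1 - ‖z‖ * ‖w‖ := by nlinarith [norm_nonneg z, norm_nonneg w]
  have h1 : 0 < ‖1 - inner ℂ w z‖ := by linarith
  unfold delta
  rw [sub_nonneg, div_le_one (by positivity)]
  calc (1 - ‖z‖ ^ 2) * (1 - ‖w‖ ^ 2) ≤ (1 - ‖z‖ * ‖w‖) ^ 2 := by nlinarith [sq_nonneg (‖z‖ - ‖w‖)]
    _ ≤ _ := by gcongr

lemma delta_lt {z w : V} (hz : ‖z‖ < 1) (hw : ‖w‖ < 1) : delta z w < 1 := by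
  have h := one_sub_inner_ge z w
  have h0 : 0 < 1 - ‖z‖ * ‖w‖ := by nlinarith [norm_nonneg z, norm_nonneg w]
  have h1 : 0 < ‖1 - inner ℂ w z‖ := by linarith
  unfold delta
  have : 0 < (1 - ‖z‖ ^ 2) * (1 - ‖w‖ ^ 2) / ‖1 - inner ℂ w z‖ ^ 2 := by
    apply div_pos (mul_pos _ _) (by positivity) <;> nlinarith [norm_nonneg z, norm_nonneg w]
  linarith

lemma sqrt_delta_zero (z : V) : Real.sqrt (delta z 0) = ‖z‖ := by
  have : delta z 0 = ‖z‖ ^ 2 := by simp [delta]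
  rw [this, Real.sqrt_sq (norm_nonneg _)]

lemma sqrt_delta_lt {z w : V} (hz : ‖z‖ < 1) (hw : ‖w‖ < 1) : Real.sqrt (delta z w) < 1 := by
  rw [Real.sqrt_lt' one_pos]; simpa using delta_lt hz hw

lemma artanh_delta_ray {z : V} (hz : ‖z‖ < 1) {t : ℝ} (ht : 0 ≤ t) (ht1 : t ≤ 1) :
    artanh (Real.sqrt (delta ((t : ℂ) • z) z)) = artanh ‖z‖ - artanh (t * ‖z‖) := by
  have h0 := norm_nonneg z
  have h1 : t * ‖z‖ ≤ ‖z‖ := by nlinarith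
  rw [artanh_sub (by positivity) (by linarith) h0 hz]
  congr 1
  have hp : 0 < 1 - t * ‖z‖ * ‖z‖ := by nlinarith
  have hn : ‖(1 : ℂ) - inner ℂ z ((t : ℂ) • z)‖ = 1 - t * ‖z‖ * ‖z‖ := by
    rw [inner_smul_right, inner_self_eq_norm_sq_to_K]
    have : (1 : ℂ) - (t : ℂ) * ((‖z‖ : ℝ) : ℂ) ^ 2 = ((1 - t * ‖z‖ * ‖z‖ : ℝ) : ℂ) := by
      push_cast; ring
    erw [this]
    rw [Complex.norm_real, Real.norm_of_nonneg hp.le]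
  have hd : delta ((t : ℂ) • z) z = ((‖z‖ - t * ‖z‖) / (1 - t * ‖z‖ * ‖z‖)) ^ 2 := by
    unfold delta
    rw [hn, norm_smul, Complex.norm_real, Real.norm_of_nonneg ht]
    have hp2 : 1 - t * ‖z‖ ^ 2 ≠ 0 := by nlinarith
    field_simp
    ring
  rw [hd, Real.sqrt_sq (div_nonneg (by linarith) hp.le)]

lemma inner_of_artanh {a b : V} (ha : ‖a‖ < 1) (hb : ‖b‖ < 1)
    (h : artanh (Real.sqrt (delta a b)) = artanh ‖b‖ - artanh ‖a‖) :
    inner ℂ b a = (‖b‖ : ℂ) * ‖a‖ := by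
  have ha0 := norm_nonneg a
  have hb0 := norm_nonneg b
  have hp : 0 < 1 - ‖a‖ * ‖b‖ := by nlinarith
  rw [artanh_sub ha0 ha hb0 hb] at h
  have h1 := artanh_inj (by linarith [Real.sqrt_nonneg (delta a b)]) (sqrt_delta_lt ha hb)
    (by rw [lt_div_iff₀ hp]; nlinarith) (by rw [div_lt_iff₀ hp]; nlinarith) h
  have h2 : delta a b = ((‖b‖ - ‖a‖) / (1 - ‖a‖ * ‖b‖)) ^ 2 := by
    rw [← h1, Real.sq_sqrt (delta_nonneg ha hb)]
  have hge := one_sub_inner_ge a b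
  have hN : 0 < ‖1 - inner ℂ b a‖ := by linarith
  have h3 : ‖1 - inner ℂ b a‖ ^ 2 = (1 - ‖a‖ * ‖b‖) ^ 2 := by
    unfold delta at h2
    have hA : 0 < (1 - ‖a‖ ^ 2) * (1 - ‖b‖ ^ 2) := by apply mul_pos <;> nlinarith
    have h4 : (1 - ‖a‖ ^ 2) * (1 - ‖b‖ ^ 2) / ‖1 - inner ℂ b a‖ ^ 2
        = (1 - ‖a‖ ^ 2) * (1 - ‖b‖ ^ 2) / (1 - ‖a‖ * ‖b‖) ^ 2 := by
      have : (1 - ‖a‖ ^ 2) * (1 - ‖b‖ ^ 2) / (1 - ‖a‖ * ‖b‖) ^ 2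
        = 1 - ((‖b‖ - ‖a‖) / (1 - ‖a‖ * ‖b‖)) ^ 2 := by
        field_simp; ring
      linarith
    rw [div_eq_div_iff (by positivity) (by positivity)] at h4
    exact (mul_left_cancel₀ hA.ne' h4).symm
  have hc := norm_inner_le_norm (𝕜 := ℂ) b a
  set c := inner ℂ b a
  rw [← Complex.normSq_eq_norm_sq, Complex.normSq_apply] at h3
  simp only [Complex.sub_re, Complex.one_re, Complex.sub_im, Complex.one_im] at h3
  have hc2 : c.re * c.re + c.im * c.im ≤ (‖b‖ * ‖a‖) ^ 2 := by
    rw [← Complex.normSq_apply, Complex.normSq_eq_norm_sq]; gcongr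
  have hre : c.re ≤ ‖b‖ * ‖a‖ := (Complex.re_le_norm c).trans hc
  have hre2 : c.re = ‖b‖ * ‖a‖ := by nlinarith
  have him : c.im = 0 := by
    rw [hre2] at hc2; nlinarith
  apply Complex.ext <;> simp [hre2, him]

lemma ray_smul {W : Type*} [NormedAddCommGroup W] [InnerProductSpace ℂ W] (g : V → W) (μ : ℝ)
    (hg : ∀ z, ‖z‖ < 1 → ‖g z‖ < 1) (hg0 : g 0 = 0)
    (hiso : ∀ z w, ‖z‖ < 1 → ‖w‖ < 1 →
      artanh (Real.sqrt (delta (g z) (g w))) = μ * artanh (Real.sqrt (delta z w))) :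
    (∀ z, ‖z‖ < 1 → artanh ‖g z‖ = μ * artanh ‖z‖) ∧
    ∀ z, ‖z‖ < 1 → ∀ t : ℝ, 0 ≤ t → t ≤ 1 →
      (‖g z‖ : ℂ) • g ((t : ℂ) • z) = (‖g ((t : ℂ) • z)‖ : ℂ) • g z := by
  have hn : ∀ z, ‖z‖ < 1 → artanh ‖g z‖ = μ * artanh ‖z‖ := by
    intro z hz
    have := hiso z 0 hz (by simp)
    rwa [hg0, sqrt_delta_zero, sqrt_delta_zero] at this
  refine ⟨hn, fun z hz t ht ht1 => ?_⟩
  have e : ‖(t : ℂ) • z‖ = t * ‖z‖ := by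
    rw [norm_smul, Complex.norm_real, Real.norm_of_nonneg ht]
  have htz : ‖(t : ℂ) • z‖ < 1 := by
    rw [e]; nlinarith [norm_nonneg z]
  have h := hiso _ _ htz hz
  rw [artanh_delta_ray hz ht ht1, mul_sub, ← e, ← hn _ hz, ← hn _ htz] at h
  exact (inner_eq_norm_mul_iff.1 (inner_of_artanh (hg _ htz) (hg _ hz) h)).symm

/-! The involutive automorphism. -/

def phiS (a : V) : ℝ := Real.sqrt (1 - ‖a‖ ^ 2)

def phi (a z : V) : V :=
  (1 - inner ℂ a z)⁻¹ • (a - (phiS a : ℂ) • z - (inner ℂ a z / (1 + phiS a)) • a)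

lemma phiS_pos {a : V} (ha : ‖a‖ < 1) : 0 < phiS a :=
  Real.sqrt_pos.2 (by nlinarith [norm_nonneg a])

lemma phiS_sq {a : V} (ha : ‖a‖ < 1) : (phiS a : ℂ) ^ 2 = 1 - (‖a‖ : ℂ) ^ 2 := by
  have : phiS a ^ 2 = 1 - ‖a‖ ^ 2 := Real.sq_sqrt (by nlinarith [norm_nonneg a])
  exact_mod_cast this

lemma inner_self_phi {a : V} (ha : ‖a‖ < 1) : inner ℂ a a = 1 - (phiS a : ℂ) ^ 2 := by
  rw [phiS_sq ha, inner_self_eq_norm_sq_to_K]; simp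

lemma phi_den_ne {a z : V} (ha : ‖a‖ < 1) (hz : ‖z‖ ≤ 1) : (1 - inner ℂ a z : ℂ) ≠ 0 := by
  have h := one_sub_inner_ge z a
  have : 0 < 1 - ‖z‖ * ‖a‖ := by nlinarith [norm_nonneg a, norm_nonneg z]
  exact norm_pos_iff.1 (by linarith)

lemma phi_one_ne {a : V} (ha : ‖a‖ < 1) : (1 + phiS a : ℂ) ≠ 0 := by
  have := phiS_pos ha
  exact_mod_cast (by linarith : (1 + phiS a : ℝ) ≠ 0)

lemma phi_inner {a z w : V} (ha : ‖a‖ < 1) (hz : ‖z‖ ≤ 1) (hw : ‖w‖ ≤ 1) :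
    1 - inner ℂ (phi a w) (phi a z) =
      (phiS a : ℂ) ^ 2 * (1 - inner ℂ w z) / ((1 - inner ℂ a z) * (1 - inner ℂ w a)) := by
  have h1 := phi_den_ne ha hz
  have h2 := phi_den_ne ha hw
  have h2' : (1 - inner ℂ w a : ℂ) ≠ 0 := by
    have := (map_ne_zero (starRingEnd ℂ)).2 h2
    simpa [inner_conj_symm] using this
  have h3 := phi_one_ne ha
  have h4 := inner_self_phi ha
  unfold phi
  simp only [inner_smul_left, inner_smul_right, inner_sub_left, inner_sub_right, h4, map_inv₀,
    map_sub, map_one, map_div₀, map_add, inner_conj_symm, Complex.conj_ofReal]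
  field_simp
  ring

lemma phi_phi {a z : V} (ha : ‖a‖ < 1) (hz : ‖z‖ ≤ 1) : phi a (phi a z) = z := by
  have h1 := phi_den_ne ha hz
  have h3 := phi_one_ne ha
  have h4 := inner_self_phi ha
  have hs : (phiS a : ℂ) ≠ 0 := by exact_mod_cast (phiS_pos ha).ne'
  have e : inner ℂ a (phi a z) = (1 - inner ℂ a z)⁻¹ * (1 - (phiS a : ℂ) ^ 2 - inner ℂ a z) := by
    unfold phi
    simp only [inner_smul_right, inner_sub_right, h4]
    field_simp
    ring
  have e2 : 1 - inner ℂ a (phi a z) = (phiS a : ℂ) ^ 2 / (1 - inner ℂ a z) := by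
    rw [e]; field_simp; ring
  rw [phi, e2, e]
  unfold phi
  match_scalars <;> field_simp <;> ring

lemma phi_self {a : V} (ha : ‖a‖ < 1) : phi a a = 0 := by
  have h3 := phi_one_ne ha
  have h4 := inner_self_phi ha
  unfold phi
  rw [h4]
  have : a - (phiS a : ℂ) • a - ((1 - (phiS a : ℂ) ^ 2) / (1 + phiS a)) • a = 0 := by
    match_scalars; field_simp; ring
  rw [this, smul_zero]

lemma phi_norm {a z : V} (ha : ‖a‖ < 1) (hz : ‖z‖ ≤ 1) :
    1 - ‖phi a z‖ ^ 2 = phiS a ^ 2 * (1 - ‖z‖ ^ 2) / ‖1 - inner ℂ a z‖ ^ 2 := by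
  have h := phi_inner ha hz hz
  have hc : (1 - inner ℂ a z : ℂ) * (1 - inner ℂ z a) = ((‖1 - inner ℂ a z‖ ^ 2 : ℝ) : ℂ) := by
    have := Complex.mul_conj' (1 - inner ℂ a z)
    simp only [map_sub, map_one, inner_conj_symm] at this
    rw [this]; push_cast; rfl
  rw [hc, inner_self_eq_norm_sq_to_K, inner_self_eq_norm_sq_to_K] at h
  have h' : ((1 - ‖phi a z‖ ^ 2 : ℝ) : ℂ)
      = ((phiS a ^ 2 * (1 - ‖z‖ ^ 2) / ‖1 - inner ℂ a z‖ ^ 2 : ℝ) : ℂ) := by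
    push_cast
    push_cast at h
    exact h
  exact_mod_cast h'

lemma phi_lt {a z : V} (ha : ‖a‖ < 1) (hz : ‖z‖ < 1) : ‖phi a z‖ < 1 := by
  have h := phi_norm ha hz.le
  have h1 := norm_pos_iff.2 (phi_den_ne ha hz.le)
  have h2 := phiS_pos ha
  have h3 : 0 < 1 - ‖z‖ ^ 2 := by nlinarith [norm_nonneg z]
  have : 0 < 1 - ‖phi a z‖ ^ 2 := by rw [h]; positivity
  nlinarith [norm_nonneg (phi a z)]

lemma phi_delta {a z w : V} (ha : ‖a‖ < 1) (hz : ‖z‖ < 1) (hw : ‖w‖ < 1) :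
    delta (phi a z) (phi a w) = delta z w := by
  have h := phi_inner ha hz.le hw.le
  unfold delta
  rw [phi_norm ha hz.le, phi_norm ha hw.le, h]
  have e : ‖(1 - inner ℂ w a : ℂ)‖ = ‖(1 - inner ℂ a w : ℂ)‖ := by
    rw [← Complex.norm_conj]; simp [inner_conj_symm]
  rw [norm_div, norm_mul, norm_mul, e, norm_pow, Complex.norm_real, Real.norm_eq_abs,
    abs_of_pos (phiS_pos ha)]
  have h1 := (norm_pos_iff.2 (phi_den_ne ha hz.le)).ne'
  have h2 := (norm_pos_iff.2 (phi_den_ne ha hw.le)).ne'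
  have hs := (phiS_pos ha).ne'
  have h5 : ‖(1 - inner ℂ w z : ℂ)‖ ≠ 0 := (norm_pos_iff.2 (phi_den_ne hw hz.le)).ne'
  field_simp

lemma phi_diff {a z : V} (ha : ‖a‖ < 1) (hz : ‖z‖ ≤ 1) : DifferentiableAt ℂ (phi a) z := by
  have h1 := phi_den_ne ha hz
  have hi : DifferentiableAt ℂ (fun z : V => inner ℂ a z) z :=
    (innerSL ℂ a).differentiableAt
  unfold phi
  apply DifferentiableAt.smul
  · exact ((differentiableAt_const _).sub hi).inv h1
  · exact ((differentiableAt_const _).sub (differentiableAt_id.const_smul _)).sub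
      (DifferentiableAt.smul_const (by simpa only [div_eq_mul_inv] using hi.mul_const _) _)

end Gen

lemma exponent_one (μ κ : ℝ) (hμ : 0 < μ) (hκ : κ ≠ 0) (τ : ℝ → ℝ)
    (h0 : ∀ r, 1 / 2 ≤ r → r < 1 → 0 ≤ τ r ∧ τ r < 1 ∧ artanh (τ r) = μ * artanh r)
    (hd : HasDerivWithinAt τ κ (Set.Icc (1 / 2) 1) 1) : μ = 1 := by
  set P : ℝ → ℝ := fun r => (1 + r) / (1 - r) with hP
  have hev : ∀ᶠ r in nhdsWithin (1 : ℝ) (Set.Iio 1), 1 / 2 ≤ r ∧ r < 1 := by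
    have := Ico_mem_nhdsLT (show (1 / 2 : ℝ) < 1 by norm_num)
    filter_upwards [this] with r hr using hr
  have hPt : Tendsto P (nhdsWithin (1 : ℝ) (Set.Iio 1)) atTop := by
    have h1 : Tendsto (fun r : ℝ => 1 - r) (nhdsWithin (1 : ℝ) (Set.Iio 1))
        (nhdsWithin 0 (Set.Ioi 0)) := by
      apply tendsto_nhdsWithin_of_tendsto_nhds_of_eventually_within
      · have : Tendsto (fun r : ℝ => 1 - r) (nhds 1) (nhds (1 - 1)) :=
          (continuous_const.sub continuous_id).tendsto _
        rw [sub_self] at this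
        exact this.mono_left nhdsWithin_le_nhds
      · filter_upwards [hev] with r hr
        simpa using hr.2
    have h2 := tendsto_inv_nhdsGT_zero.comp h1
    refine tendsto_atTop_mono' _ ?_ h2
    filter_upwards [hev] with r hr
    have : 0 < 1 - r := by linarith
    simp only [Function.comp, hP, inv_eq_one_div]
    gcongr
    linarith
  have hrel : ∀ r, 1 / 2 ≤ r → r < 1 → (1 + τ r) / (1 - τ r) = P r ^ μ ∧ 0 < P r := by
    intro r hr hr1
    obtain ⟨a, b, c⟩ := h0 r hr hr1
    have hPr : 0 < P r := div_pos (by linarith) (by linarith)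
    refine ⟨?_, hPr⟩
    unfold artanh at c
    have c' : Real.log ((1 + τ r) / (1 - τ r)) = Real.log (P r ^ μ) := by
      rw [Real.log_rpow hPr]; simp only [hP]; linarith
    exact Real.log_injOn_pos (Set.mem_Ioi.2 (div_pos (by linarith) (by linarith)))
      (Set.mem_Ioi.2 (Real.rpow_pos_of_pos hPr _)) c'
  have hform : ∀ r, 1 / 2 ≤ r → r < 1 → 1 - τ r = 2 / (1 + P r ^ μ) := by
    intro r hr hr1
    obtain ⟨a, b, c⟩ := h0 r hr hr1
    rw [← (hrel r hr hr1).1]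
    have : 1 - τ r ≠ 0 := by linarith
    have : (1 + (1 + τ r) / (1 - τ r)) = 2 / (1 - τ r) := by field_simp; ring
    rw [this]
    field_simp
  have hPμ : Tendsto (fun r => P r ^ μ) (nhdsWithin (1 : ℝ) (Set.Iio 1)) atTop :=
    (tendsto_rpow_atTop hμ).comp hPt
  have hτ1 : τ 1 = 1 := by
    have h1 : Tendsto τ (nhdsWithin (1 : ℝ) (Set.Iio 1)) (nhds (τ 1)) := by
      have := hd.continuousWithinAt
      rw [ContinuousWithinAt] at this
      refine this.mono_left ?_
      rw [← nhdsWithin_Ico_eq_nhdsLT (show (1 / 2 : ℝ) < 1 by norm_num)]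
      exact nhdsWithin_mono _ Set.Ico_subset_Icc_self
    have h2 : Tendsto (fun r => 1 - 2 / (1 + P r ^ μ)) (nhdsWithin (1 : ℝ) (Set.Iio 1))
        (nhds (1 - 0)) :=
      tendsto_const_nhds.sub (tendsto_const_nhds.div_atTop (tendsto_atTop_add_const_left _ _ hPμ))
    rw [sub_zero] at h2
    refine tendsto_nhds_unique h1 (h2.congr' ?_)
    filter_upwards [hev] with r hr
    rw [← hform r hr.1 hr.2]; ring
  have hsl : Tendsto (fun r => (1 + P r) / (1 + P r ^ μ)) (nhdsWithin (1 : ℝ) (Set.Iio 1))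
      (nhds κ) := by
    rw [hasDerivWithinAt_iff_tendsto_slope] at hd
    have h3 : nhdsWithin (1 : ℝ) (Set.Iio 1) ≤ nhdsWithin 1 (Set.Icc (1 / 2) 1 \ {1}) := by
      rw [← nhdsWithin_Ico_eq_nhdsLT (show (1 / 2 : ℝ) < 1 by norm_num)]
      exact nhdsWithin_mono _ fun r hr => ⟨⟨hr.1, hr.2.le⟩, hr.2.ne⟩
    refine (hd.mono_left h3).congr' ?_
    filter_upwards [hev] with r hr
    rw [slope_def_field, hτ1]
    have e1 := hform r hr.1 hr.2
    have e2 : 1 - r = 2 / (1 + P r) := by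
      have : 1 - r ≠ 0 := by linarith [hr.2]
      have : (1 + P r) = 2 / (1 - r) := by simp only [hP]; field_simp; ring
      rw [this]; field_simp
    have hPr := (hrel r hr.1 hr.2).2
    have : 0 < P r ^ μ := Real.rpow_pos_of_pos hPr _
    rw [show τ r - 1 = -(1 - τ r) by ring, show r - 1 = -(1 - r) by ring, neg_div_neg_eq, e1, e2]
    field_simp
  have hlim : Tendsto (fun r => P r ^ (1 - μ)) (nhdsWithin (1 : ℝ) (Set.Iio 1)) (nhds κ) := by
    have i1 : Tendsto (fun r => (1 + (P r ^ μ)⁻¹) / (1 + (P r)⁻¹))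
        (nhdsWithin (1 : ℝ) (Set.Iio 1)) (nhds ((1 + 0) / (1 + 0))) :=
      (tendsto_const_nhds.add hPμ.inv_tendsto_atTop).div
        (tendsto_const_nhds.add hPt.inv_tendsto_atTop) (by norm_num)
    have i2 := hsl.mul i1
    simp only [add_zero, div_one, mul_one] at i2
    refine i2.congr' ?_
    filter_upwards [hev] with r hr
    have hPr := (hrel r hr.1 hr.2).2
    have : 0 < P r ^ μ := Real.rpow_pos_of_pos hPr _
    rw [Real.rpow_sub hPr, Real.rpow_one]
    field_simp
    ring
  rcases lt_trichotomy μ 1 with h | h | h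
  · have := (tendsto_rpow_atTop (show 0 < 1 - μ by linarith)).comp hPt
    exact absurd hlim (not_tendsto_nhds_of_tendsto_atTop this κ)
  · exact h
  · have := (tendsto_rpow_neg_atTop (show 0 < μ - 1 by linarith)).comp hPt
    have e := tendsto_nhds_unique this (by simpa [Function.comp_def] using hlim)
    exact absurd e.symm hκ

lemma mu_one {n m : ℕ} (μ : ℝ) (hμ : 0 < μ)
    (f : EuclideanSpace ℂ (Fin n) → EuclideanSpace ℂ (Fin m))
    (hmap : ∀ z, ‖z‖ < 1 → ‖f z‖ < 1)
    (hiso : ∀ z w, ‖z‖ < 1 → ‖w‖ < 1 →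
      artanh (Real.sqrt (delta (phi (f 0) (f z)) (phi (f 0) (f w))))
        = μ * artanh (Real.sqrt (delta z w)))
    (q : EuclideanSpace ℂ (Fin n)) (hq : ‖q‖ = 1) (F' : EuclideanSpace ℂ (Fin m)) (hF' : F' ≠ 0)
    (hd : HasDerivWithinAt (fun r : ℝ => f ((r : ℂ) • q)) F' (Set.Icc (1 / 2) 1) 1) : μ = 1 := by
  have ha : ‖f 0‖ < 1 := hmap 0 (by simp)
  set a := f 0 with hadef
  have hrq : ∀ r : ℝ, 0 ≤ r → ‖(r : ℂ) • q‖ = r := by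
    intro r hr
    rw [norm_smul, Complex.norm_real, Real.norm_of_nonneg hr, hq, mul_one]
  obtain ⟨hn, hray⟩ := ray_smul (fun z => phi a (f z)) μ (fun z hz => phi_lt ha (hmap z hz))
    (phi_self ha) hiso
  set F : ℝ → EuclideanSpace ℂ (Fin m) := fun r => f ((r : ℂ) • q) with hF
  set G : ℝ → EuclideanSpace ℂ (Fin m) := fun r => phi a (F r) with hG
  have hnb : (nhdsWithin (1 : ℝ) (Set.Iio 1)) ≤ nhdsWithin 1 (Set.Icc (1 / 2) 1) := by
    rw [← nhdsWithin_Ico_eq_nhdsLT (show (1 / 2 : ℝ) < 1 by norm_num)]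
    exact nhdsWithin_mono _ Set.Ico_subset_Icc_self
  have hev : ∀ᶠ r in nhdsWithin (1 : ℝ) (Set.Iio 1), 1 / 2 ≤ r ∧ r < 1 := by
    have := Ico_mem_nhdsLT (show (1 / 2 : ℝ) < 1 by norm_num)
    filter_upwards [this] with r hr using hr
  have hFlt : ∀ r, 1 / 2 ≤ r → r < 1 → ‖F r‖ < 1 := fun r hr hr1 =>
    hmap _ (by rw [hrq r (by linarith)]; exact hr1)
  have hF1 : ‖F 1‖ ≤ 1 := by
    have h1 : Tendsto F (nhdsWithin (1 : ℝ) (Set.Iio 1)) (nhds (F 1)) :=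
      hd.continuousWithinAt.mono_left hnb
    refine le_of_tendsto h1.norm ?_
    filter_upwards [hev] with r hr using (hFlt r hr.1 hr.2).le
  have hGd : HasDerivWithinAt G (fderiv ℝ (phi a) (F 1) F') (Set.Icc (1 / 2) 1) 1 := by
    have h1 : DifferentiableAt ℝ (phi a) (F 1) := (phi_diff ha hF1).restrictScalars ℝ
    exact h1.hasFDerivAt.comp_hasDerivWithinAt 1 hd
  set G' := fderiv ℝ (phi a) (F 1) F'
  have hGt : Tendsto G (nhdsWithin (1 : ℝ) (Set.Iio 1)) (nhds (G 1)) :=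
    hGd.continuousWithinAt.mono_left hnb
  have hG1 : ‖G 1‖ ≤ 1 := by
    refine le_of_tendsto hGt.norm ?_
    filter_upwards [hev] with r hr using (phi_lt ha (hFlt r hr.1 hr.2)).le
  have hud : UniqueDiffWithinAt ℝ (Set.Icc (1 / 2 : ℝ) 1) 1 :=
    uniqueDiffOn_Icc (by norm_num) 1 (by norm_num)
  have hFG : ∀ r ∈ Set.Icc (1 / 2 : ℝ) 1, F r = phi a (G r) := by
    intro r hr
    rcases hr.2.lt_or_eq with h | h
    · exact (phi_phi ha (hFlt r hr.1 h).le).symm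
    · rw [h]; exact (phi_phi ha hF1).symm
  have hG' : G' ≠ 0 := by
    intro h
    have h1 : DifferentiableAt ℝ (phi a) (G 1) := (phi_diff ha hG1).restrictScalars ℝ
    have h2 := h1.hasFDerivAt.comp_hasDerivWithinAt 1 hGd
    rw [h, map_zero] at h2
    have h3 : HasDerivWithinAt F 0 (Set.Icc (1 / 2) 1) 1 :=
      h2.congr_of_mem hFG (by norm_num)
    exact hF' (hud.eq_deriv _ hd h3)
  have hnG : ∀ r, 1 / 2 ≤ r → r < 1 → artanh ‖G r‖ = μ * artanh r := by
    intro r hr hr1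
    have := hn ((r : ℂ) • q) (by rw [hrq r (by linarith)]; exact hr1)
    rwa [hrq r (by linarith)] at this
  have hGh : ‖G (1 / 2)‖ ≠ 0 := by
    intro h
    have h1 := hnG (1 / 2) le_rfl (by norm_num)
    rw [h] at h1
    have h00 : artanh 0 = 0 := by simp [artanh]
    rw [h00] at h1
    have h2 : artanh (1 / 2) = artanh 0 := by
      rw [h00]
      rcases mul_eq_zero.1 h1.symm with h | h
      · exact absurd h hμ.ne'
      · exact h
    have := artanh_inj (by norm_num) (by norm_num) (by norm_num) (by norm_num) h2
    norm_num at this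
  set v : EuclideanSpace ℂ (Fin m) := ((‖G (1 / 2)‖ : ℂ)⁻¹) • G (1 / 2) with hv
  have hGh' : (‖G (1 / 2)‖ : ℂ) ≠ 0 := by exact_mod_cast hGh
  have hvn : ‖v‖ = 1 := by
    rw [hv, norm_smul, norm_inv, Complex.norm_real, norm_norm, inv_mul_cancel₀ hGh]
  have hGv : ∀ r, 1 / 2 ≤ r → r < 1 → G r = (‖G r‖ : ℂ) • v := by
    intro r hr hr1
    have hr0 : r ≠ 0 := by linarith
    have h1 := hray ((r : ℂ) • q) (by rw [hrq r (by linarith)]; exact hr1) (1 / 2 / r)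
      (by apply div_nonneg <;> linarith) (by rw [div_le_one (by linarith)]; exact hr)
    have h2 : ((1 / 2 / r : ℝ) : ℂ) • (r : ℂ) • q = ((1 / 2 : ℝ) : ℂ) • q := by
      rw [smul_smul, ← Complex.ofReal_mul, div_mul_cancel₀ _ hr0]
    rw [h2] at h1
    change (‖G r‖ : ℂ) • G (1 / 2) = (‖G (1 / 2)‖ : ℂ) • G r at h1
    rw [hv, smul_smul, mul_comm, ← smul_smul, h1, smul_smul, inv_mul_cancel₀ hGh', one_smul]
  set τ : ℝ → ℝ := fun r => (inner ℂ v (G r)).re with hτ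
  have hvv : inner ℂ v v = (1 : ℂ) := by rw [inner_self_eq_norm_sq_to_K, hvn]; simp
  have hτG : ∀ r, 1 / 2 ≤ r → r < 1 → τ r = ‖G r‖ := by
    intro r hr hr1
    simp only [hτ]
    rw [hGv r hr hr1, inner_smul_right, hvv, mul_one, Complex.ofReal_re, norm_smul, hvn]
    simp
  let T : EuclideanSpace ℂ (Fin m) →L[ℝ] ℝ :=
    Complex.reCLM.comp ((innerSL ℂ v).restrictScalars ℝ)
  have hτd : HasDerivWithinAt τ (T G') (Set.Icc (1 / 2) 1) 1 :=
    T.hasFDerivAt.comp_hasDerivWithinAt 1 hGd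
  have hτv : ∀ r ∈ Set.Icc (1 / 2 : ℝ) 1, G r = τ r • v := by
    have hlt : ∀ r, 1 / 2 ≤ r → r < 1 → G r = τ r • v := by
      intro r hr hr1
      rw [hτG r hr hr1, ← Complex.coe_smul]; exact hGv r hr hr1
    intro r hr
    rcases hr.2.lt_or_eq with h | h
    · exact hlt r hr.1 h
    · rw [h]
      have h1 : Tendsto (fun r => τ r • v) (nhdsWithin (1 : ℝ) (Set.Iio 1)) (nhds (τ 1 • v)) :=
        Tendsto.smul_const (hτd.continuousWithinAt.mono_left hnb) v
      refine tendsto_nhds_unique hGt (h1.congr' ?_)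
      filter_upwards [hev] with r hr using (hlt r hr.1 hr.2).symm
  have hκ : T G' ≠ 0 := by
    intro h
    have h1 := hτd.smul_const v
    rw [h, zero_smul] at h1
    have h3 : HasDerivWithinAt G 0 (Set.Icc (1 / 2) 1) 1 := h1.congr_of_mem hτv (by norm_num)
    exact hG' (hud.eq_deriv _ hGd h3)
  refine exponent_one μ _ hμ hκ τ (fun r hr hr1 => ?_) hτd
  rw [hτG r hr hr1]
  exact ⟨norm_nonneg _, phi_lt ha (hFlt r hr hr1), hnG r hr hr1⟩

lemma two_cover {A : Type*} [AddCommGroup A] (p r : A → Prop) (hc : ∀ x, p x ∨ r x)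
    (hp : ∀ x y, p x → p y → p (x - y)) (hr : ∀ x y, r x → r y → r (x - y)) :
    (∀ x, p x) ∨ (∀ x, r x) := by
  by_contra h
  push Not at h
  obtain ⟨⟨x, hx⟩, ⟨y, hy⟩⟩ := h
  have hx' := (hc x).resolve_left hx
  have hy' := (hc y).resolve_right hy
  have p0 : p 0 := by simpa using hp y y hy' hy'
  have r0 : r 0 := by simpa using hr x x hx' hx'
  rcases hc (x - y) with h | h
  · have h1 : p (-y) := by simpa using hp 0 y p0 hy'
    exact hx (by simpa using hp _ _ h h1)
  · have h1 := hr x _ hx' h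
    exact hy (by simpa using h1)

lemma rigidity {V W : Type*} [NormedAddCommGroup V] [InnerProductSpace ℂ V]
    [NormedAddCommGroup W] [InnerProductSpace ℂ W] (G : V → W)
    (hre : ∀ x y, (inner ℂ (G x) (G y)).re = (inner ℂ x y).re)
    (him : ∀ x y, (inner ℂ (G x) (G y)).im ^ 2 = (inner ℂ x y).im ^ 2) :
    (∀ x y, inner ℂ (G x) (G y) = inner ℂ x y) ∨
    (∀ x y, inner ℂ (G x) (G y) = inner ℂ y x) := by
  have hsub : ∀ x y, G (x - y) = G x - G y := by
    intro x y
    have h : (inner ℂ (G (x - y) - (G x - G y)) (G (x - y) - (G x - G y))).re = 0 := by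
      simp only [inner_sub_left, inner_sub_right, Complex.sub_re, hre]
      ring
    have h2 : G (x - y) - (G x - G y) = 0 := by
      rw [← norm_eq_zero, ← sq_eq_zero_iff, ← inner_self_eq_norm_sq (𝕜 := ℂ)]
      exact h
    exact sub_eq_zero.1 h2
  have key : (∀ x y, (inner ℂ (G x) (G y)).im = (inner ℂ x y).im) ∨
      (∀ x y, (inner ℂ (G x) (G y)).im = -(inner ℂ x y).im) := by
    apply two_cover (fun x => ∀ y, (inner ℂ (G x) (G y)).im = (inner ℂ x y).im)
      (fun x => ∀ y, (inner ℂ (G x) (G y)).im = -(inner ℂ x y).im)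
    · intro x
      apply two_cover (fun y => (inner ℂ (G x) (G y)).im = (inner ℂ x y).im)
        (fun y => (inner ℂ (G x) (G y)).im = -(inner ℂ x y).im)
      · intro y; exact sq_eq_sq_iff_eq_or_eq_neg.1 (him x y)
      · intro y z h1 h2
        simp only [hsub, inner_sub_right, Complex.sub_im, h1, h2]
      · intro y z h1 h2
        simp only [hsub, inner_sub_right, Complex.sub_im, h1, h2]; ring
    · intro y z h1 h2 w
      simp only [hsub, inner_sub_left, Complex.sub_im, h1, h2]
    · intro y z h1 h2 w
      simp only [hsub, inner_sub_left, Complex.sub_im, h1, h2]; ring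
  rcases key with h | h
  · left; intro x y; exact Complex.ext (hre x y) (h x y)
  · right; intro x y
    rw [← inner_conj_symm y x]
    exact Complex.ext ((hre x y).trans (Complex.conj_re _).symm) ((h x y).trans (Complex.conj_im _).symm)

lemma exists_unitary {n m : ℕ} (hnm : n ≤ m)
    (H : EuclideanSpace ℂ (Fin n) → EuclideanSpace ℂ (Fin m))
    (hH : ∀ x y, inner ℂ (H x) (H y) = inner ℂ x y) :
    ∃ W : EuclideanSpace ℂ (Fin m) ≃ₗᵢ[ℂ] EuclideanSpace ℂ (Fin m),
      ∀ z, W (H z) = inclBall n m z := by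
  obtain ⟨k, rfl⟩ := Nat.exists_eq_add_of_le hnm
  let e : Fin n → EuclideanSpace ℂ (Fin n) := fun i => EuclideanSpace.single i 1
  let v : Fin (n + k) → EuclideanSpace ℂ (Fin (n + k)) := fun j =>
    if h : (j : ℕ) < n then H (e ⟨j, h⟩) else 0
  let s : Set (Fin (n + k)) := {j | (j : ℕ) < n}
  have hv : Orthonormal ℂ (s.domRestrict v) := by
    rw [orthonormal_iff_ite]
    rintro ⟨i, hi⟩ ⟨j, hj⟩
    have hi' : (i : ℕ) < n := hi
    have hj' : (j : ℕ) < n := hj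
    have ei : v i = H (e ⟨i, hi'⟩) := dif_pos hi'
    have ej : v j = H (e ⟨j, hj'⟩) := dif_pos hj'
    change inner ℂ (v i) (v j) = _
    rw [ei, ej, hH]
    simp only [e, EuclideanSpace.inner_single_left, PiLp.single_apply, Subtype.mk.injEq,
      Fin.ext_iff, map_one, one_mul]
  obtain ⟨b, hb⟩ := hv.exists_orthonormalBasis_extension_of_card_eq (by simp)
  refine ⟨b.repr, fun z => ?_⟩
  have hco : ∀ i : Fin n, b.repr (H z) (Fin.castAdd k i) = z i := by
    intro i
    have hi : (Fin.castAdd k i) ∈ s := by simp [s]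
    rw [b.repr_apply_apply, hb _ hi]
    simp only [v, Fin.val_castAdd, Fin.is_lt, dif_pos, hH, e]
    simp [EuclideanSpace.inner_single_left]
  have hnorm : ‖b.repr (H z)‖ ^ 2 = ‖z‖ ^ 2 := by
    rw [LinearIsometryEquiv.norm_map, ← inner_self_eq_norm_sq (𝕜 := ℂ),
      ← inner_self_eq_norm_sq (𝕜 := ℂ), hH]
  rw [EuclideanSpace.norm_sq_eq, EuclideanSpace.norm_sq_eq, Fin.sum_univ_add] at hnorm
  simp only [hco, add_eq_left] at hnorm
  rw [Finset.sum_eq_zero_iff_of_nonneg (fun _ _ => by positivity)] at hnorm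
  ext j
  refine Fin.addCases (fun i => ?_) (fun i => ?_) j
  · rw [hco]; simp [inclBall]
  · have := hnorm i (Finset.mem_univ _)
    have h0 : b.repr (H z) (Fin.natAdd n i) = 0 := by simpa using this
    rw [h0]; simp [inclBall]

lemma inner_conjVec {n : ℕ} (x y : EuclideanSpace ℂ (Fin n)) :
    inner ℂ (conjVec n x) (conjVec n y) = inner ℂ y x := by
  simp [PiLp.inner_apply, conjVec, mul_comm]

lemma conjVec_conjVec {n : ℕ} (x : EuclideanSpace ℂ (Fin n)) :
    conjVec n (conjVec n x) = x := by
  ext j; simp [conjVec]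

lemma ball_rigidity {V W : Type*} [NormedAddCommGroup V] [InnerProductSpace ℂ V]
    [NormedAddCommGroup W] [InnerProductSpace ℂ W] (g : V → W)
    (hg : ∀ z, ‖z‖ < 1 → ‖g z‖ < 1) (hg0 : g 0 = 0)
    (hiso : ∀ z w, ‖z‖ < 1 → ‖w‖ < 1 →
      artanh (Real.sqrt (delta (g z) (g w))) = 1 * artanh (Real.sqrt (delta z w))) :
    ∃ G : V → W, (∀ z, ‖z‖ < 1 → G z = g z) ∧
    ((∀ x y, inner ℂ (G x) (G y) = inner ℂ x y) ∨
    (∀ x y, inner ℂ (G x) (G y) = inner ℂ y x)) := by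
  obtain ⟨hn, hray⟩ := ray_smul g 1 hg hg0 hiso
  have hnorm : ∀ z, ‖z‖ < 1 → ‖g z‖ = ‖z‖ := by
    intro z hz
    have := hn z hz
    rw [one_mul] at this
    exact artanh_inj (by linarith [norm_nonneg (g z)]) (hg z hz) (by linarith [norm_nonneg z]) hz this
  have hlt : ∀ z : V, ‖z‖ < 1 → ∀ t : ℝ, 0 ≤ t → t ≤ 1 → ‖(t : ℂ) • z‖ < 1 := by
    intro z hz t ht ht1
    rw [norm_smul, Complex.norm_real, Real.norm_of_nonneg ht]
    nlinarith [norm_nonneg z]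
  have hhom : ∀ z, ‖z‖ < 1 → ∀ t : ℝ, 0 ≤ t → t ≤ 1 → g ((t : ℂ) • z) = (t : ℂ) • g z := by
    intro z hz t ht ht1
    by_cases h0 : z = 0
    · subst h0; simp [hg0]
    have h := hray z hz t ht ht1
    rw [hnorm z hz, hnorm _ (hlt z hz t ht ht1), norm_smul, Complex.norm_real,
      Real.norm_of_nonneg ht, Complex.ofReal_mul, mul_comm, ← smul_smul] at h
    have hz0 : (‖z‖ : ℂ) ≠ 0 := by exact_mod_cast norm_ne_zero_iff.2 h0
    exact smul_right_injective W hz0 h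
  have habs : ∀ z w, ‖z‖ < 1 → ‖w‖ < 1 →
      ‖1 - inner ℂ (g w) (g z)‖ ^ 2 = ‖1 - inner ℂ w z‖ ^ 2 := by
    intro z w hz hw
    have h := hiso z w hz hw
    rw [one_mul] at h
    have h1 := artanh_inj (by linarith [Real.sqrt_nonneg (delta (g z) (g w))])
      (sqrt_delta_lt (hg z hz) (hg w hw))
      (by linarith [Real.sqrt_nonneg (delta z w)]) (sqrt_delta_lt hz hw) h
    rw [Real.sqrt_inj (delta_nonneg (hg z hz) (hg w hw)) (delta_nonneg hz hw)] at h1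
    unfold delta at h1
    rw [hnorm z hz, hnorm w hw] at h1
    have hA : 0 < (1 - ‖z‖ ^ 2) * (1 - ‖w‖ ^ 2) := by
      apply mul_pos <;> nlinarith [norm_nonneg z, norm_nonneg w]
    have p1 := norm_pos_iff.2 (phi_den_ne (hg w hw) (hg z hz).le)
    have p2 := norm_pos_iff.2 (phi_den_ne hw hz.le)
    have h2 := sub_right_injective h1
    rw [div_eq_div_iff (by positivity) (by positivity)] at h2
    exact (mul_left_cancel₀ hA.ne' h2).symm
  have hexp : ∀ c : ℂ, ‖1 - c‖ ^ 2 = 1 - 2 * c.re + (c.re ^ 2 + c.im ^ 2) := by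
    intro c
    rw [← Complex.normSq_eq_norm_sq, Complex.normSq_apply]
    simp; ring
  have hin : ∀ z w, ‖z‖ < 1 → ‖w‖ < 1 → (inner ℂ (g w) (g z)).re = (inner ℂ w z).re ∧
      (inner ℂ (g w) (g z)).im ^ 2 = (inner ℂ w z).im ^ 2 := by
    intro z w hz hw
    have h1 := habs z w hz hw
    have h2 := habs (((1 / 2 : ℝ) : ℂ) • z) w (hlt z hz _ (by norm_num) (by norm_num)) hw
    rw [hhom z hz _ (by norm_num) (by norm_num), inner_smul_right, inner_smul_right] at h2
    rw [hexp, hexp] at h1 h2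
    simp only [Complex.re_ofReal_mul, Complex.im_ofReal_mul] at h2
    have h3 : (inner ℂ (g w) (g z)).re = (inner ℂ w z).re := by linarith
    refine ⟨h3, ?_⟩
    rw [h3] at h1
    linarith
  let c : V → ℝ := fun z => 1 + ‖z‖
  have hc : ∀ z, 0 < c z := fun z => by positivity
  have hc1 : ∀ z, 1 ≤ c z := fun z => by simp [c]
  have hcn : ∀ z, ‖((c z)⁻¹ : ℂ) • z‖ < 1 := by
    intro z
    rw [norm_smul, norm_inv, Complex.norm_real, Real.norm_of_nonneg (hc z).le, inv_mul_lt_iff₀ (hc z)]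
    simp [c]
  let G : V → W := fun z => (c z : ℂ) • g (((c z)⁻¹ : ℂ) • z)
  have hcc : ∀ z, (c z : ℂ) ≠ 0 := fun z => by exact_mod_cast (hc z).ne'
  have hGin : ∀ x y, (inner ℂ (G x) (G y)).re = (inner ℂ x y).re ∧
      (inner ℂ (G x) (G y)).im ^ 2 = (inner ℂ x y).im ^ 2 := by
    intro x y
    have h := hin _ _ (hcn y) (hcn x)
    have e1 : inner ℂ (G x) (G y) = ((c x * c y : ℝ) : ℂ) *
        inner ℂ (g (((c x)⁻¹ : ℂ) • x)) (g (((c y)⁻¹ : ℂ) • y)) := by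
      simp only [G, inner_smul_left, inner_smul_right, Complex.conj_ofReal]
      push_cast; ring
    have e2 : inner ℂ x y = ((c x * c y : ℝ) : ℂ) *
        inner ℂ (((c x)⁻¹ : ℂ) • x) (((c y)⁻¹ : ℂ) • y) := by
      simp only [inner_smul_left, inner_smul_right, Complex.conj_ofReal, map_inv₀]
      have := hcc x
      have := hcc y
      push_cast; field_simp
    rw [e1, e2]
    simp only [Complex.re_ofReal_mul, Complex.im_ofReal_mul]
    rw [h.1, mul_pow, h.2]
    exact ⟨rfl, by ring⟩
  refine ⟨G, fun z hz => ?_, rigidity G (fun x y => (hGin x y).1) (fun x y => (hGin x y).2)⟩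
  have := hhom z hz (c z)⁻¹ (inv_nonneg.2 (hc z).le) (inv_le_one_of_one_le₀ (hc1 z))
  simp only [G]
  rw [Complex.ofReal_inv] at this
  rw [this, smul_smul, mul_inv_cancel₀ (hcc z), one_smul]

lemma aut_comp {m : ℕ} (a : EuclideanSpace ℂ (Fin m)) (ha : ‖a‖ < 1)
    (W : EuclideanSpace ℂ (Fin m) ≃ₗᵢ[ℂ] EuclideanSpace ℂ (Fin m)) :
    IsBiholoAutBall m (fun z => W (phi a z)) := by
  refine ⟨?_, ?_, fun z => phi a (W.symm z), ?_, ?_, ?_, ?_⟩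
  · intro z hz
    rw [mem_ball_zero_iff] at hz ⊢
    simpa using phi_lt ha hz
  · intro z hz
    rw [mem_ball_zero_iff] at hz
    exact (W.differentiable.differentiableAt.comp z (phi_diff ha hz.le)).differentiableWithinAt
  · intro z hz
    rw [mem_ball_zero_iff] at hz ⊢
    exact phi_lt ha (by simpa using hz)
  · intro z hz
    rw [mem_ball_zero_iff] at hz
    have h : DifferentiableAt ℂ (phi a) (W.symm z) := phi_diff ha (by simpa using hz.le)
    exact (h.comp z W.symm.differentiable.differentiableAt).differentiableWithinAt
  · intro z hz
    rw [mem_ball_zero_iff] at hz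
    simp [phi_phi ha hz.le]
  · intro z hz
    rw [mem_ball_zero_iff] at hz
    have : ‖W.symm z‖ ≤ 1 := by simpa using hz.le
    simp [phi_phi ha this]

/-- **Theorem 1.2** (both domains unit balls). A `C²`-smooth totally geodesic isometric
embedding `f : (B^n, λ g_{B^n}) → (B^m, g_{B^m})` which extends `C¹` over an open subset of
the unit sphere (the Shilov boundary) with nowhere vanishing radial derivative satisfies
`λ = 1` and is, up to an automorphism of `B^m`, the standard embedding or its conjugate. -/
theorem totally_geodesic_ball_in_ball_boundary
    (n m : ℕ) (hn : 0 < n) (hnm : n ≤ m) (lam : ℝ) (hlam : 0 < lam)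
    (f : EuclideanSpace ℂ (Fin n) → EuclideanSpace ℂ (Fin m))
    (hmap : Set.MapsTo f (Metric.ball 0 1) (Metric.ball 0 1))
    (hC2 : ContDiffOn ℝ 2 f (Metric.ball 0 1))
    (hiso : ∀ z ∈ Metric.ball (0 : EuclideanSpace ℂ (Fin n)) 1,
      ∀ w ∈ Metric.ball (0 : EuclideanSpace ℂ (Fin n)) 1,
        ballDist (f z) (f w) = Real.sqrt lam * ballDist z w)
    (U : Set (EuclideanSpace ℂ (Fin n)))
    (hU : U ⊆ Metric.sphere 0 1) (hUne : U.Nonempty)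
    (hUopen : ∃ V : Set (EuclideanSpace ℂ (Fin n)), IsOpen V ∧ U = V ∩ Metric.sphere 0 1)
    (hC1 : ContDiffOn ℝ 1 f (Metric.ball 0 1 ∪ U))
    (hrad : ∀ q ∈ U, fderivWithin ℝ f (Metric.ball 0 1 ∪ U) q q ≠ 0) :
    lam = 1 ∧
    ∃ Ψ : EuclideanSpace ℂ (Fin m) → EuclideanSpace ℂ (Fin m), IsBiholoAutBall m Ψ ∧
      ((∀ z ∈ Metric.ball (0 : EuclideanSpace ℂ (Fin n)) 1, Ψ (f z) = inclBall n m z) ∨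
       (∀ z ∈ Metric.ball (0 : EuclideanSpace ℂ (Fin n)) 1,
          Ψ (f z) = inclBall n m (conjVec n z))) := by
  have hmap' : ∀ z, ‖z‖ < 1 → ‖f z‖ < 1 := by
    intro z hz
    simpa using hmap (by simpa using hz : z ∈ Metric.ball 0 1)
  have ha : ‖f 0‖ < 1 := hmap' 0 (by simp)
  have hiso' : ∀ z w, ‖z‖ < 1 → ‖w‖ < 1 →
      artanh (Real.sqrt (delta (phi (f 0) (f z)) (phi (f 0) (f w))))
        = Real.sqrt lam * artanh (Real.sqrt (delta z w)) := by
    intro z w hz hw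
    rw [phi_delta ha (hmap' z hz) (hmap' w hw), ← ballDist_eq, ← ballDist_eq]
    exact hiso z (by simpa using hz) w (by simpa using hw)
  obtain ⟨q, hqU⟩ := hUne
  have hq : ‖q‖ = 1 := by simpa using hU hqU
  have hμ : Real.sqrt lam = 1 := by
    refine mu_one _ (Real.sqrt_pos.2 hlam) f hmap' hiso' q hq _ (hrad q hqU) ?_
    have hfd : HasFDerivWithinAt f (fderivWithin ℝ f (Metric.ball 0 1 ∪ U) q)
        (Metric.ball 0 1 ∪ U) q :=
      ((hC1 q (Or.inr hqU)).differentiableWithinAt one_ne_zero).hasFDerivWithinAt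
    have hr : HasDerivWithinAt (fun r : ℝ => (r : ℂ) • q) q (Set.Icc (1 / 2) 1) 1 := by
      have := ((hasDerivAt_id (1 : ℝ)).smul_const q).hasDerivWithinAt (s := Set.Icc (1 / 2) 1)
      simpa [Complex.coe_smul] using this
    refine hfd.comp_hasDerivWithinAt_of_eq (1 : ℝ) hr ?_ (by simp)
    intro r hr
    rcases hr.2.lt_or_eq with h | h
    · left
      rw [mem_ball_zero_iff, norm_smul, Complex.norm_real,
        Real.norm_of_nonneg (by linarith [hr.1]), hq, mul_one]
      exact h
    · right; rw [h]; simpa using hqU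
  rw [hμ] at hiso'
  refine ⟨by simpa using hμ, ?_⟩
  obtain ⟨G, hG, hor⟩ := ball_rigidity (fun z => phi (f 0) (f z))
    (fun z hz => phi_lt ha (hmap' z hz)) (phi_self ha) hiso'
  rcases hor with h | h
  · obtain ⟨W, hW⟩ := exists_unitary hnm G h
    refine ⟨_, aut_comp (f 0) ha W, Or.inl fun z hz => ?_⟩
    rw [mem_ball_zero_iff] at hz
    rw [← hW z, hG z hz]
  · obtain ⟨W, hW⟩ := exists_unitary hnm (fun z => G (conjVec n z))
      (fun x y => by rw [h, inner_conjVec])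
    refine ⟨_, aut_comp (f 0) ha W, Or.inr fun z hz => ?_⟩
    rw [mem_ball_zero_iff] at hz
    rw [← hW (conjVec n z), conjVec_conjVec, hG z hz]
end
end
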